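/- arXiv:2107.07583 — 4 statements merged into one kernel-verified Lean document; each statement's English description precedes it below -/
import Mathlib

section
/- Let F ∈ ℤ₂[X] be a monic symmetric polynomial. Then there exists a unimodular ℤ₂-lattice having a semisimple isometry with characteristic polynomial F if and only if F(1)·F(−1) = 0 or the 2-adic valuation of F(1)·F(−1) is even. -/
open Polynomial Matrix

/-- A monic polynomial with nonzero constant term is *symmetric* if
`X^{deg F} · F(1/X) = F(0) · F(X)`, i.e. `F.reverse = C (F 0) * F`. -/
def IsSymmPoly {R : Type*} [CommRing R] (F : Polynomial R) : Prop :=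
  F.reverse = Polynomial.C (F.coeff 0) * F

/-- There exists a unimodular `ℤ₂`-lattice having a semisimple isometry with
characteristic polynomial `F`. -/
def HasSemisimpleIsometryUnimodularPadic (p : ℕ) [Fact p.Prime]
    (F : Polynomial ℤ_[p]) : Prop :=
  ∃ G T : Matrix (Fin F.natDegree) (Fin F.natDegree) ℤ_[p],
    G.IsSymm ∧ IsUnit G.det ∧ IsUnit T.det ∧ Tᵀ * G * T = G ∧
    Module.End.IsSemisimple (Matrix.toLin' (T.map (PadicInt.Coe.ringHom : ℤ_[p] →+* ℚ_[p]))) ∧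
    (T.map (PadicInt.Coe.ringHom : ℤ_[p] →+* ℚ_[p])).charpoly =
      F.map (PadicInt.Coe.ringHom : ℤ_[p] →+* ℚ_[p])

section TwoAdic

theorem two_dvd_iff_toZMod_eq_zero (x : ℤ_[2]) : (2 : ℤ_[2]) ∣ x ↔ PadicInt.toZMod x = 0 := by
  rw [← RingHom.mem_ker, PadicInt.ker_toZMod, PadicInt.maximalIdeal_eq_span_p,
    Ideal.mem_span_singleton]
  norm_num

theorem isUnit_iff_not_two_dvd (x : ℤ_[2]) : IsUnit x ↔ ¬ (2 : ℤ_[2]) ∣ x := by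
  rw [two_dvd_iff_toZMod_eq_zero, ← RingHom.mem_ker, PadicInt.ker_toZMod,
    IsLocalRing.mem_maximalIdeal, mem_nonunits_iff, not_not]

theorem two_dvd_add_of_not_dvd {x y : ℤ_[2]} (hx : ¬ (2 : ℤ_[2]) ∣ x) (hy : ¬ (2 : ℤ_[2]) ∣ y) :
    (2 : ℤ_[2]) ∣ x + y := by
  rw [two_dvd_iff_toZMod_eq_zero] at *
  rw [map_add]
  generalize PadicInt.toZMod x = a at *
  generalize PadicInt.toZMod y = b at *
  revert a b
  decide

theorem valuation_eq_zero_of_isUnit {x : ℤ_[2]} (hx : IsUnit x) : x.valuation = 0 := by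
  have h := PadicInt.isUnit_iff.1 hx
  rw [PadicInt.norm_eq_zpow_neg_valuation hx.ne_zero] at h
  rw [_root_.zpow_neg, inv_eq_one, zpow_natCast] at h
  rcases Nat.eq_zero_or_pos x.valuation with h0 | h0
  · exact h0
  · exact absurd h (one_lt_pow₀ (by norm_num) h0.ne').ne'

theorem isUnit_of_valuation_eq_zero {x : ℤ_[2]} (h0 : x ≠ 0) (hx : x.valuation = 0) :
    IsUnit x := by
  rw [PadicInt.isUnit_iff, PadicInt.norm_eq_zpow_neg_valuation h0, hx]
  simp

theorem valuation_two : (2 : ℤ_[2]).valuation = 1 := by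
  simpa using PadicInt.valuation_p (p := 2)

variable {ι : Type*} [Fintype ι] [DecidableEq ι]

/-- A nonzero determinant divisible by `2` gives a vector, nonzero modulo `2`, which is killed
modulo `2`. -/
theorem exists_mulVec_eq_two_smul {A : Matrix ι ι ℤ_[2]} (hA : (2 : ℤ_[2]) ∣ A.det) :
    ∃ w : ι → ℤ_[2], (∃ i, IsUnit (w i)) ∧ ∃ u, A *ᵥ w = (2 : ℤ_[2]) • u := by
  have h : (A.map (PadicInt.toZMod (p := 2))).det = 0 := by
    rw [two_dvd_iff_toZMod_eq_zero, RingHom.map_det] at hA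
    exact hA
  obtain ⟨v, hv0, hv⟩ := Matrix.exists_mulVec_eq_zero_iff.2 h
  choose w hw using fun i => (ZMod.ringHom_surjective (PadicInt.toZMod (p := 2))) (v i)
  refine ⟨w, ?_, ?_⟩
  · by_contra! hc
    refine hv0 (funext fun i => ?_)
    have := hc i
    rw [isUnit_iff_not_two_dvd, not_not, two_dvd_iff_toZMod_eq_zero, hw] at this
    exact this
  · have : ∀ i, (2 : ℤ_[2]) ∣ (A *ᵥ w) i := fun i => by
      rw [two_dvd_iff_toZMod_eq_zero, RingHom.map_mulVec]
      have h2 : (⇑(PadicInt.toZMod (p := 2)) ∘ w) = v := funext hw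
      rw [h2, hv]
      rfl
    choose u hu using this
    exact ⟨u, funext fun i => by rw [hu]; rfl⟩

/-- `T` is an isometry of the nondegenerate symmetric lattice with Gram matrix `G`, and `T ^ 2`
acts trivially on the discriminant module of this lattice. -/
structure IsInvolutivePair (G T : Matrix ι ι ℤ_[2]) : Prop where
  symm : G.IsSymm
  isom : Tᵀ * G * T = G
  det_ne : G.det ≠ 0
  sq : ∃ W, T * T - 1 = W * G

theorem isUnit_det_of_isom {G T : Matrix ι ι ℤ_[2]} (hG : G.det ≠ 0) (h : Tᵀ * G * T = G) :
    IsUnit T.det := by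
  have h1 := congrArg det h
  rw [det_mul, det_mul, det_transpose] at h1
  have h2 : T.det * T.det = 1 := mul_left_cancel₀ hG (by linear_combination h1)
  exact IsUnit.of_mul_eq_one _ h2

namespace IsInvolutivePair

variable {G T : Matrix ι ι ℤ_[2]}

theorem dotProduct_comm (h : IsInvolutivePair G T) (x y : ι → ℤ_[2]) :
    x ⬝ᵥ (G *ᵥ y) = y ⬝ᵥ (G *ᵥ x) := by
  rw [dotProduct_mulVec, ← mulVec_transpose, h.symm, _root_.dotProduct_comm]

theorem dotProduct_isom (h : IsInvolutivePair G T) (x y : ι → ℤ_[2]) :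
    (T *ᵥ x) ⬝ᵥ (G *ᵥ (T *ᵥ y)) = x ⬝ᵥ (G *ᵥ y) := by
  conv_rhs => rw [← h.isom]
  rw [← mulVec_mulVec, ← mulVec_mulVec, dotProduct_mulVec x, vecMul_transpose]

theorem mulVec_isom (h : IsInvolutivePair G T) {w u : ι → ℤ_[2]}
    (hw : G *ᵥ w = (2 : ℤ_[2]) • u) : ∃ u', G *ᵥ (T *ᵥ w) = (2 : ℤ_[2]) • u' := by
  have hT : IsUnit Tᵀ.det := by rw [det_transpose]; exact isUnit_det_of_isom h.det_ne h.isom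
  refine ⟨Tᵀ⁻¹ *ᵥ u, ?_⟩
  rw [← mulVec_smul, ← hw]
  conv_rhs => rw [← h.isom]
  simp only [mulVec_mulVec, ← Matrix.mul_assoc, nonsing_inv_mul _ hT, Matrix.one_mul]

/-- Any element of order two of the discriminant module gives one which is fixed by `T`. -/
theorem exists_fixed (h : IsInvolutivePair G T) {w u : ι → ℤ_[2]} (hw0 : ∃ i, IsUnit (w i))
    (hw : G *ᵥ w = (2 : ℤ_[2]) • u) :
    ∃ z : ι → ℤ_[2], (∃ i, IsUnit (z i)) ∧ (∃ u, G *ᵥ z = (2 : ℤ_[2]) • u) ∧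
      (∃ u, T *ᵥ z - z = (2 : ℤ_[2]) • u) ∧
      ∀ x x' : ι → ℤ_[2], T *ᵥ x - x = (2 : ℤ_[2]) • x' → (4 : ℤ_[2]) ∣ w ⬝ᵥ (G *ᵥ x) →
        (4 : ℤ_[2]) ∣ z ⬝ᵥ (G *ᵥ x) := by
  by_cases hfix : ∀ i, (2 : ℤ_[2]) ∣ (T *ᵥ w - w) i
  · choose v hv using hfix
    exact ⟨w, hw0, ⟨u, hw⟩, ⟨v, funext hv⟩, fun x x' _ hx => hx⟩
  · push Not at hfix
    obtain ⟨i, hi⟩ := hfix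
    obtain ⟨W, hW⟩ := h.sq
    obtain ⟨u', hu'⟩ := h.mulVec_isom hw
    refine ⟨T *ᵥ w - w, ⟨i, (isUnit_iff_not_two_dvd _).2 hi⟩, ⟨u' - u, ?_⟩,
      ⟨W *ᵥ u - T *ᵥ w + w, ?_⟩, ?_⟩
    · rw [mulVec_sub, hu', hw, smul_sub]
    · have h2 : T *ᵥ (T *ᵥ w) - w = (2 : ℤ_[2]) • (W *ᵥ u) := by
        rw [← mulVec_smul, ← hw, mulVec_mulVec, mulVec_mulVec, ← hW, sub_mulVec, one_mulVec]
      rw [mulVec_sub, smul_add, smul_sub, ← h2, two_smul, two_smul]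
      abel
    · rintro x x' hx ⟨c, hc⟩
      have hxT : x = T *ᵥ x - (2 : ℤ_[2]) • x' := by rw [← hx]; abel
      have h3 : (T *ᵥ w) ⬝ᵥ (G *ᵥ x) = w ⬝ᵥ (G *ᵥ x) - 4 * (x' ⬝ᵥ u') := by
        conv_lhs => rw [hxT]
        rw [mulVec_sub, dotProduct_sub, h.dotProduct_isom, mulVec_smul, dotProduct_smul,
          h.dotProduct_comm (T *ᵥ w), hu', dotProduct_smul, smul_eq_mul, smul_eq_mul]
        ring
      rw [sub_dotProduct, h3]
      exact ⟨-(x' ⬝ᵥ u'), by ring⟩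

/-- If the determinant is divisible by `4`, the discriminant module contains an isotropic element
of order two which is fixed by `T`. -/
theorem exists_isotropic (h : IsInvolutivePair G T) (hd : (4 : ℤ_[2]) ∣ G.det) :
    ∃ z : ι → ℤ_[2], (∃ i, IsUnit (z i)) ∧ (∃ u, G *ᵥ z = (2 : ℤ_[2]) • u) ∧
      (∃ u, T *ᵥ z - z = (2 : ℤ_[2]) • u) ∧ (4 : ℤ_[2]) ∣ z ⬝ᵥ (G *ᵥ z) := by
  obtain ⟨w₀, hw₀, u₀, hu₀⟩ := exists_mulVec_eq_two_smul
    (Dvd.dvd.trans ⟨2, by norm_num⟩ hd)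
  obtain ⟨w, ⟨i, hi⟩, ⟨u, hu⟩, ⟨v, hv⟩, -⟩ := h.exists_fixed hw₀ hu₀
  by_cases hw4 : (4 : ℤ_[2]) ∣ w ⬝ᵥ (G *ᵥ w)
  · exact ⟨w, ⟨i, hi⟩, ⟨u, hu⟩, ⟨v, hv⟩, hw4⟩
  have hdet : (G.updateRow i u).det * 2 = w i * G.det := by
    have h1 : G.updateRow i ((2 : ℤ_[2]) • u) = (1 : Matrix ι ι ℤ_[2]).updateRow i w * G := by
      rw [← hu]
      ext j k
      by_cases hj : j = i
      · subst hj
        rw [updateRow_self, Matrix.mul_apply]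
        simp only [updateRow_self]
        rw [mulVec, dotProduct]
        exact Finset.sum_congr rfl fun l _ => by rw [← h.symm.apply l k, mul_comm]
      · rw [updateRow_ne hj, Matrix.mul_apply]
        simp only [updateRow_ne hj]
        rw [← Matrix.mul_apply, Matrix.one_mul]
    have h2 := congrArg det h1
    rw [det_updateRow_smul, det_mul] at h2
    have h3 : ((1 : Matrix ι ι ℤ_[2]).updateRow i w).det = w i := by
      rw [← det_transpose, ← updateCol_transpose, transpose_one, ← cramer_apply, cramer_one]
      rfl
    rw [h3] at h2
    rw [← h2, mul_comm]
  have h2det : (2 : ℤ_[2]) ∣ (G.updateRow i u).det := by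
    obtain ⟨c, hc⟩ := hd
    exact ⟨w i * c, mul_right_cancel₀ (two_ne_zero) (by rw [hdet, hc]; ring)⟩
  obtain ⟨y, hy0, r, hr⟩ := exists_mulVec_eq_two_smul h2det
  have hrow : ∀ j, j ≠ i → (G *ᵥ y) j = 2 * r j := fun j hj => by
    have := congrFun hr j
    simpa [mulVec, updateRow_ne hj] using this
  have hui : u ⬝ᵥ y = 2 * r i := by
    have := congrFun hr i
    simpa [mulVec] using this
  have hwy : w ⬝ᵥ (G *ᵥ y) = 4 * r i := by
    rw [h.dotProduct_comm, hu, dotProduct_smul, _root_.dotProduct_comm, hui, smul_eq_mul]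
    ring
  have hGy : ∀ j, (2 : ℤ_[2]) ∣ (G *ᵥ y) j := fun j => by
    by_cases hj : j = i
    · subst hj
      rw [dotProduct, ← Finset.add_sum_erase _ _ (Finset.mem_univ j)] at hwy
      have h4 : (2 : ℤ_[2]) ∣ ∑ k ∈ Finset.univ.erase j, w k * (G *ᵥ y) k :=
        Finset.dvd_sum fun k hk => by
          rw [hrow k (Finset.ne_of_mem_erase hk)]
          exact ⟨w k * r k, by ring⟩
      rw [← hi.dvd_mul_left]
      obtain ⟨s, hs⟩ := h4
      exact ⟨2 * r j - s, by linear_combination hwy - hs⟩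
    · exact ⟨_, hrow j hj⟩
  choose q hq using hGy
  obtain ⟨z, hz0, ⟨a, ha⟩, ⟨b, hb⟩, hzx⟩ := h.exists_fixed hy0 (funext hq : G *ᵥ y = (2 : ℤ_[2]) • q)
  have hzw : (4 : ℤ_[2]) ∣ z ⬝ᵥ (G *ᵥ w) :=
    hzx w v hv ⟨r i, by rw [h.dotProduct_comm, hwy]⟩
  by_cases hz4 : (4 : ℤ_[2]) ∣ z ⬝ᵥ (G *ᵥ z)
  · exact ⟨z, hz0, ⟨a, ha⟩, ⟨b, hb⟩, hz4⟩
  refine ⟨w + z, ?_, ⟨u + a, by rw [mulVec_add, hu, ha, smul_add]⟩,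
    ⟨v + b, by rw [mulVec_add, smul_add, ← hv, ← hb]; abel⟩, ?_⟩
  · by_contra! hc
    have : ∀ j, (2 : ℤ_[2]) ∣ w j + z j := fun j => by
      by_contra hj
      exact hc j ((isUnit_iff_not_two_dvd _).2 hj)
    choose e he using this
    have he' : w = (2 : ℤ_[2]) • e - z := by
      ext j
      simp [← he]
    apply hw4
    conv => rhs; lhs; rw [he']
    rw [sub_dotProduct, hu, dotProduct_smul, smul_dotProduct, ← hu, smul_eq_mul, smul_eq_mul]
    refine dvd_sub ⟨e ⬝ᵥ u, by ring⟩ hzw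
  · have hexp : (w + z) ⬝ᵥ (G *ᵥ (w + z)) =
        w ⬝ᵥ (G *ᵥ w) + z ⬝ᵥ (G *ᵥ z) + 2 * (z ⬝ᵥ (G *ᵥ w)) := by
      rw [mulVec_add, dotProduct_add, add_dotProduct, add_dotProduct, h.dotProduct_comm w z]
      ring
    rw [hexp]
    refine dvd_add ?_ (hzw.mul_left 2)
    rw [hu, ha, dotProduct_smul, dotProduct_smul, smul_eq_mul, smul_eq_mul] at *
    have h2 : ∀ t : ℤ_[2], (4 : ℤ_[2]) ∣ 2 * t ↔ (2 : ℤ_[2]) ∣ t := fun t => by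
      rw [show (4 : ℤ_[2]) = 2 * 2 by norm_num]
      exact mul_dvd_mul_iff_left two_ne_zero
    rw [h2] at hw4 hz4
    rw [← mul_add, h2]
    exact two_dvd_add_of_not_dvd hw4 hz4

end IsInvolutivePair

end TwoAdic

section Enlarge

variable {ι : Type*} [Fintype ι] [DecidableEq ι]

theorem mul_diagonal_right_cancel {d : ι → ℤ_[2]} (hd : ∀ i, d i ≠ 0) {A B : Matrix ι ι ℤ_[2]}
    (h : A * diagonal d = B * diagonal d) : A = B := by
  ext i j
  have := congrFun (congrFun h i) j
  rw [mul_diagonal, mul_diagonal] at this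
  exact mul_right_cancel₀ (hd j) this

theorem mul_diagonal_left_cancel {d : ι → ℤ_[2]} (hd : ∀ i, d i ≠ 0) {A B : Matrix ι ι ℤ_[2]}
    (h : diagonal d * A = diagonal d * B) : A = B := by
  ext i j
  have := congrFun (congrFun h i) j
  rw [diagonal_mul, diagonal_mul] at this
  exact mul_left_cancel₀ (hd i) this

namespace IsInvolutivePair

variable {G T : Matrix ι ι ℤ_[2]}

theorem conj (h : IsInvolutivePair G T) {P Q : Matrix ι ι ℤ_[2]} (hPQ : P * Q = 1) :
    IsInvolutivePair (Pᵀ * G * P) (Q * T * P) where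
  symm := by
    rw [IsSymm, transpose_mul, transpose_mul, transpose_transpose, h.symm, Matrix.mul_assoc]
  isom := by
    have hQP : Qᵀ * Pᵀ = 1 := by rw [← transpose_mul, hPQ, transpose_one]
    calc (Q * T * P)ᵀ * (Pᵀ * G * P) * (Q * T * P)
        = Pᵀ * Tᵀ * (Qᵀ * Pᵀ) * G * (P * Q) * T * P := by
          simp only [transpose_mul, Matrix.mul_assoc]
      _ = Pᵀ * (Tᵀ * G * T) * P := by
          rw [hPQ, hQP]; simp only [Matrix.mul_assoc, Matrix.mul_one]
      _ = Pᵀ * G * P := by rw [h.isom]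
  det_ne := by
    have hP : P.det ≠ 0 := (isUnit_det_of_right_inverse hPQ).ne_zero
    rw [det_mul, det_mul, det_transpose]
    exact mul_ne_zero (mul_ne_zero hP h.det_ne) hP
  sq := by
    obtain ⟨W, hW⟩ := h.sq
    have hQP : Qᵀ * Pᵀ = 1 := by rw [← transpose_mul, hPQ, transpose_one]
    refine ⟨Q * W * Qᵀ, ?_⟩
    calc Q * T * P * (Q * T * P) - 1 = Q * T * (P * Q) * T * P - Q * P := by
          rw [mul_eq_one_comm.1 hPQ]; simp only [Matrix.mul_assoc]
      _ = Q * (T * T - 1) * P := by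
          rw [hPQ, Matrix.mul_sub, Matrix.sub_mul]
          simp only [Matrix.mul_assoc, Matrix.mul_one]
      _ = Q * W * (Qᵀ * Pᵀ) * G * P := by
          rw [hW, hQP]; simp only [Matrix.mul_assoc, Matrix.one_mul]
      _ = Q * W * Qᵀ * (Pᵀ * G * P) := by simp only [Matrix.mul_assoc]

theorem of_diagonal (h : IsInvolutivePair G T) {G' T' : Matrix ι ι ℤ_[2]} {d : ι → ℤ_[2]}
    (hd : ∀ i, d i ≠ 0) (hG : diagonal d * G' * diagonal d = G)
    (hT : T' * diagonal d = diagonal d * T) : IsInvolutivePair G' T' where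
  symm := by
    apply mul_diagonal_left_cancel hd
    apply mul_diagonal_right_cancel hd
    rw [hG]
    conv_rhs => rw [← h.symm, ← hG]
    simp only [transpose_mul, diagonal_transpose, Matrix.mul_assoc]
  isom := by
    have hT2 : diagonal d * T'ᵀ = Tᵀ * diagonal d := by
      have := congrArg transpose hT
      rwa [transpose_mul, transpose_mul, diagonal_transpose] at this
    apply mul_diagonal_left_cancel hd
    apply mul_diagonal_right_cancel hd
    rw [hG]
    calc diagonal d * (T'ᵀ * G' * T') * diagonal d
        = (diagonal d * T'ᵀ) * G' * (T' * diagonal d) := by simp only [Matrix.mul_assoc]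
      _ = Tᵀ * (diagonal d * G' * diagonal d) * T := by
          rw [hT, hT2]; simp only [Matrix.mul_assoc]
      _ = G := by rw [hG, h.isom]
  det_ne := fun h0 => h.det_ne (by rw [← hG, det_mul, det_mul, h0, mul_zero, zero_mul])
  sq := by
    obtain ⟨W, hW⟩ := h.sq
    refine ⟨diagonal d * W * diagonal d, ?_⟩
    apply mul_diagonal_right_cancel hd
    calc (T' * T' - 1) * diagonal d = diagonal d * (T * T - 1) := by
          rw [Matrix.sub_mul, Matrix.mul_assoc, hT, ← Matrix.mul_assoc, hT, Matrix.mul_sub,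
            Matrix.mul_assoc, Matrix.one_mul, Matrix.mul_one]
      _ = diagonal d * W * diagonal d * G' * diagonal d := by
          rw [hW, ← hG]; simp only [Matrix.mul_assoc]

/-- Enlarging the lattice by half of the `i`-th basis vector. -/
theorem exists_of_single (h : IsInvolutivePair G T) (i : ι)
    (hGi : ∀ j, (2 : ℤ_[2]) ∣ G j i) (hii : (4 : ℤ_[2]) ∣ G i i)
    (hTi : ∀ j, j ≠ i → (2 : ℤ_[2]) ∣ T j i) :
    ∃ G' T' N : Matrix ι ι ℤ_[2], IsInvolutivePair G' T' ∧ G.det = 4 * G'.det ∧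
      N.det ≠ 0 ∧ T' * N = N * T := by
  set d : ι → ℤ_[2] := Function.update 1 i 2 with hd
  have hdi : d i = 2 := by simp [hd]
  have hdj : ∀ j, j ≠ i → d j = 1 := fun j hj => by simp [hd, hj]
  have hd0 : ∀ j, d j ≠ 0 := fun j => by
    by_cases hj : j = i
    · subst hj; rw [hdi]; exact two_ne_zero
    · rw [hdj j hj]; exact one_ne_zero
  have hGdvd : ∀ j k, d j * d k ∣ G j k := fun j k => by
    by_cases hj : j = i <;> by_cases hk : k = i
    · subst hj hk; rw [hdi]; norm_num; exact hii
    · subst hj; rw [hdi, hdj k hk, mul_one, ← h.symm.apply]; exact hGi k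
    · subst hk; rw [hdi, hdj j hj, one_mul]; exact hGi j
    · rw [hdj j hj, hdj k hk, one_mul]; exact one_dvd _
  have hTdvd : ∀ j k, d k ∣ d j * T j k := fun j k => by
    by_cases hk : k = i
    · subst hk
      by_cases hj : j = k
      · subst hj; exact dvd_mul_right _ _
      · rw [hdi]; exact (hTi j hj).mul_left _
    · rw [hdj k hk]; exact one_dvd _
  choose G' hG' using hGdvd
  choose T' hT' using hTdvd
  have hGG : diagonal d * of G' * diagonal d = G := by
    ext j k
    rw [mul_diagonal, diagonal_mul, hG', of_apply]
    ring
  have hTT : of T' * diagonal d = diagonal d * T := by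
    ext j k
    rw [mul_diagonal, diagonal_mul, hT', of_apply]
    ring
  have hdet : (diagonal d).det = 2 := by
    rw [det_diagonal, hd, Finset.prod_update_of_mem (Finset.mem_univ i)]
    simp
  refine ⟨of G', of T', diagonal d, h.of_diagonal hd0 hGG hTT, ?_, ?_, hTT⟩
  · rw [← hGG, det_mul, det_mul, hdet]; ring
  · rw [hdet]; exact two_ne_zero

theorem exists_enlarge (h : IsInvolutivePair G T) (hd : (4 : ℤ_[2]) ∣ G.det) :
    ∃ G' T' N : Matrix ι ι ℤ_[2], IsInvolutivePair G' T' ∧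
      G.det.valuation = G'.det.valuation + 2 ∧ N.det ≠ 0 ∧ T' * N = N * T := by
  obtain ⟨w, ⟨i, hi⟩, ⟨u, hu⟩, ⟨v, hv⟩, hw4⟩ := h.exists_isotropic hd
  set P : Matrix ι ι ℤ_[2] := (1 : Matrix ι ι ℤ_[2]).updateCol i w with hP
  have hPdet : IsUnit P.det := by
    rw [hP, ← cramer_apply, cramer_one]
    exact hi
  have hPi : P *ᵥ Pi.single i 1 = w := by
    rw [mulVec_single_one, hP]
    ext j
    simp
  have hPP : P * P⁻¹ = 1 := mul_nonsing_inv _ hPdet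
  have hPP' : P⁻¹ * P = 1 := nonsing_inv_mul _ hPdet
  have hPw : P⁻¹ *ᵥ w = Pi.single i 1 := by rw [← hPi, mulVec_mulVec, hPP', one_mulVec]
  have hGi : (Pᵀ * G * P) *ᵥ Pi.single i 1 = (2 : ℤ_[2]) • (Pᵀ *ᵥ u) := by
    rw [← mulVec_mulVec, hPi, ← mulVec_mulVec, hu, mulVec_smul]
  have hTi : (P⁻¹ * T * P) *ᵥ Pi.single i 1 = Pi.single i 1 + (2 : ℤ_[2]) • (P⁻¹ *ᵥ v) := by
    rw [← mulVec_mulVec, hPi, ← mulVec_mulVec, ← mulVec_smul, ← hv, mulVec_sub, hPw]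
    abel
  obtain ⟨G', T', N, h', hdet, hN, hTN⟩ := (h.conj hPP).exists_of_single i
    (fun j => by
      have := congrFun hGi j
      rw [mulVec_single_one] at this
      exact ⟨_, this⟩)
    (by
      have h1 : (Pᵀ * G * P) i i = Pi.single i 1 ⬝ᵥ ((Pᵀ * G * P) *ᵥ Pi.single i 1) := by
        simp
      rw [h1, Matrix.mul_assoc, ← mulVec_mulVec, dotProduct_mulVec, vecMul_transpose,
        ← mulVec_mulVec, hPi]
      exact hw4)
    (fun j hj => by
      have := congrFun hTi j
      rw [mulVec_single_one] at this
      rw [Pi.add_apply, Pi.single_eq_of_ne hj, zero_add] at this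
      exact ⟨_, this⟩)
  refine ⟨G', T', N * P⁻¹, h', ?_, ?_, ?_⟩
  · have h1 : (Pᵀ * G * P).det.valuation = G.det.valuation := by
      rw [det_mul, det_mul, det_transpose,
        PadicInt.valuation_mul (mul_ne_zero hPdet.ne_zero h.det_ne) hPdet.ne_zero,
        PadicInt.valuation_mul hPdet.ne_zero h.det_ne, valuation_eq_zero_of_isUnit hPdet]
      omega
    rw [← h1, hdet, show (4 : ℤ_[2]) = 2 * 2 by norm_num,
      PadicInt.valuation_mul (by norm_num) h'.det_ne, PadicInt.valuation_mul two_ne_zero two_ne_zero,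
      valuation_two]
    omega
  · rw [det_mul]
    exact mul_ne_zero hN (isUnit_nonsing_inv_det _ hPdet).ne_zero
  · rw [← Matrix.mul_assoc, hTN]
    simp only [Matrix.mul_assoc, hPP, Matrix.mul_one]

theorem four_dvd_det (h : IsInvolutivePair G T) (h2 : 2 ≤ G.det.valuation) :
    (4 : ℤ_[2]) ∣ G.det := by
  have := (PadicInt.mem_span_pow_iff_le_valuation G.det h.det_ne 2).2 h2
  rw [Ideal.mem_span_singleton] at this
  norm_num at this
  exact this

/-- If the valuation of the determinant is even, the lattice is contained in a unimodular one which
is stable under the isometry. -/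
theorem exists_unimodular (h : IsInvolutivePair G T) (hd : Even G.det.valuation) :
    ∃ G' T' N : Matrix ι ι ℤ_[2], IsInvolutivePair G' T' ∧ IsUnit G'.det ∧
      N.det ≠ 0 ∧ T' * N = N * T := by
  obtain ⟨n, hn⟩ := hd
  induction n generalizing G T with
  | zero => exact ⟨G, T, 1, h, isUnit_of_valuation_eq_zero h.det_ne hn, by simp, by simp⟩
  | succ n ih =>
    obtain ⟨G₁, T₁, N₁, h₁, hv₁, hN₁, hT₁⟩ := h.exists_enlarge (h.four_dvd_det (by omega))
    obtain ⟨G₂, T₂, N₂, h₂, hu₂, hN₂, hT₂⟩ := ih h₁ (by omega)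
    refine ⟨G₂, T₂, N₂ * N₁, h₂, hu₂, by rw [det_mul]; exact mul_ne_zero hN₂ hN₁, ?_⟩
    rw [← Matrix.mul_assoc, hT₂, Matrix.mul_assoc, hT₁, Matrix.mul_assoc]

end IsInvolutivePair

end Enlarge

section Necessity

/-- The determinant of a skew-symmetric matrix over a field of characteristic not two is a
square. -/
theorem isSquare_det_of_transpose_eq_neg {K : Type*} [Field K] (h2 : (2 : K) ≠ 0)
    {ι : Type} [Fintype ι] [DecidableEq ι] (A : Matrix ι ι K) (hA : Aᵀ = -A) :
    IsSquare A.det := by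
  obtain ⟨n, hn⟩ : ∃ n, Fintype.card ι = n := ⟨_, rfl⟩
  induction n using Nat.strong_induction_on generalizing ι with
  | _ n ih =>
  have hskew : ∀ i j, A j i = -A i j := fun i j => congrFun (congrFun hA i) j
  by_cases h0 : ∀ i j, A i j = 0
  · have hA0 : A = 0 := by ext i j; exact h0 i j
    rcases isEmpty_or_nonempty ι with he | he
    · rw [det_isEmpty]; exact IsSquare.one
    · rw [hA0, det_zero]; exact IsSquare.zero
  push Not at h0
  obtain ⟨i, j, hij⟩ := h0
  have hdiag : ∀ k, A k k = 0 := fun k => by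
    have h3 : 2 * A k k = 0 := by linear_combination hskew k k
    exact (mul_eq_zero.1 h3).resolve_left h2
  have hne : i ≠ j := by
    rintro rfl
    exact hij (hdiag i)
  have hinj : Function.Injective ![i, j] := by
    intro a b hab
    fin_cases a <;> fin_cases b
    · rfl
    · exact absurd hab hne
    · exact absurd hab hne.symm
    · rfl
  classical
  let e : Fin 2 ⊕ {k // k ∉ Set.range ![i, j]} ≃ ι :=
    ((Equiv.ofInjective _ hinj).sumCongr (Equiv.refl _)).trans
      (Equiv.sumCompl (· ∈ Set.range ![i, j]))
  have hcard : Fintype.card {k // k ∉ Set.range ![i, j]} < n := by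
    have := Fintype.card_congr e
    rw [Fintype.card_sum, Fintype.card_fin] at this
    omega
  set B := A.submatrix e e with hB
  have hBskew : ∀ a b, B b a = -B a b := fun a b => hskew _ _
  have hdet : A.det = B.det := (det_submatrix_equiv_self e A).symm
  have e0 : e (Sum.inl 0) = i := rfl
  have e1 : e (Sum.inl 1) = j := rfl
  have h11 : B.toBlocks₁₁.det = A i j * A i j := by
    rw [det_fin_two]
    simp only [toBlocks₁₁, of_apply, hB, submatrix_apply, e0, e1, hdiag]
    rw [hskew i j]
    ring
  have hunit : IsUnit B.toBlocks₁₁.det := by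
    rw [h11]; exact (mul_ne_zero hij hij).isUnit
  let _ : Invertible B.toBlocks₁₁ := invertibleOfIsUnitDet _ hunit
  have t11 : B.toBlocks₁₁ᵀ = -B.toBlocks₁₁ := by ext a b; exact hBskew _ _
  have t12 : B.toBlocks₁₂ᵀ = -B.toBlocks₂₁ := by ext a b; exact hBskew _ _
  have t21 : B.toBlocks₂₁ᵀ = -B.toBlocks₁₂ := by ext a b; exact hBskew _ _
  have t22 : B.toBlocks₂₂ᵀ = -B.toBlocks₂₂ := by ext a b; exact hBskew _ _
  have hinv : (B.toBlocks₁₁⁻¹)ᵀ = -B.toBlocks₁₁⁻¹ := by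
    rw [transpose_nonsing_inv, t11]
    apply inv_eq_left_inv
    rw [neg_mul_neg, nonsing_inv_mul _ hunit]
  rw [hdet, ← fromBlocks_toBlocks B, det_fromBlocks₁₁, h11]
  refine IsSquare.mul ⟨A i j, rfl⟩ (ih _ hcard _ ?_ rfl)
  rw [invOf_eq_nonsing_inv, transpose_sub, transpose_mul, transpose_mul, t12, t21, t22, hinv]
  simp only [Matrix.mul_assoc, Matrix.neg_mul, Matrix.mul_neg, neg_neg, neg_sub]
  abel

theorem even_valuation_of_isom {n : ℕ} {G T : Matrix (Fin n) (Fin n) ℤ_[2]} (hG : G.IsSymm)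
    (hdet : IsUnit G.det) (h : Tᵀ * G * T = G)
    (h0 : T.charpoly.eval 1 * T.charpoly.eval (-1) ≠ 0) :
    Even (T.charpoly.eval 1 * T.charpoly.eval (-1)).valuation := by
  set a := T.charpoly.eval 1 * T.charpoly.eval (-1) with ha
  have hT := isUnit_det_of_isom hdet.ne_zero h
  have haT : a = ((T - 1) * (T + 1)).det := by
    rw [ha, eval_charpoly, eval_charpoly, ← det_mul]
    congr 1
    simp only [map_neg, map_one]
    noncomm_ring
  have hA : (G * T - Tᵀ * G)ᵀ = -(G * T - Tᵀ * G) := by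
    rw [transpose_sub, transpose_mul, transpose_mul, transpose_transpose, hG, neg_sub]
  have hAT : (G * T - Tᵀ * G).det * T.det = G.det * a := by
    rw [haT, ← det_mul, ← det_mul]
    congr 1
    rw [Matrix.sub_mul, h]
    noncomm_ring
  obtain ⟨c, hc⟩ := isSquare_det_of_transpose_eq_neg (K := ℚ_[2]) two_ne_zero
    ((G * T - Tᵀ * G).map PadicInt.Coe.ringHom) (by
      rw [← transpose_map, hA]
      ext i j
      exact map_neg PadicInt.Coe.ringHom _)
  set b := (G * T - Tᵀ * G).det
  have hc' : (b : ℚ_[2]) = c * c := by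
    rw [← hc]
    exact RingHom.map_det PadicInt.Coe.ringHom _
  have hb0 : b ≠ 0 := fun hb => by
    rw [hb, zero_mul] at hAT
    exact mul_ne_zero hdet.ne_zero h0 hAT.symm
  have hc0 : c ≠ 0 := by
    rintro rfl
    rw [mul_zero] at hc'
    exact hb0 (Subtype.ext hc')
  have hv := congrArg PadicInt.valuation hAT
  rw [PadicInt.valuation_mul hb0 hT.ne_zero, PadicInt.valuation_mul hdet.ne_zero h0,
    valuation_eq_zero_of_isUnit hT, valuation_eq_zero_of_isUnit hdet] at hv
  have hbc := congrArg Padic.valuation hc'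
  rw [PadicInt.valuation_coe, Padic.valuation_mul hc0 hc0] at hbc
  have : Even (b.valuation : ℤ) := ⟨_, hbc⟩
  rw [Int.even_coe_nat] at this
  rwa [show a.valuation = b.valuation by omega]

end Necessity

section Semisimple

variable {ι κ : Type*} [Fintype ι] [DecidableEq ι] [Fintype κ] [DecidableEq κ]

/-- A matrix over a field annihilated by a nonzero radical polynomial. -/
def IsSemisimpleMatrix {K : Type*} [Field K] (M : Matrix ι ι K) : Prop :=
  ∃ r : K[X], r ≠ 0 ∧ IsRadical r ∧ aeval M r = 0

theorem aeval_fromBlocks {K : Type*} [Field K] (A : Matrix ι ι K) (B : Matrix κ κ K) (r : K[X]) :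
    aeval (fromBlocks A 0 0 B) r = fromBlocks (aeval A r) 0 0 (aeval B r) := by
  induction r using Polynomial.induction_on' with
  | add p q hp hq => simp only [map_add, hp, hq, fromBlocks_add, add_zero]
  | monomial n a =>
    have hpow : (fromBlocks A 0 0 B) ^ n = fromBlocks (A ^ n) 0 0 (B ^ n) := by
      induction n with
      | zero => simp
      | succ n ih => simp [pow_succ, ih, fromBlocks_multiply]
    rw [aeval_monomial, aeval_monomial, aeval_monomial, hpow]
    simp only [← Algebra.smul_def]
    rw [fromBlocks_smul, smul_zero, smul_zero]

namespace IsSemisimpleMatrix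

variable {K : Type*} [Field K]

theorem fromBlocks {A : Matrix ι ι K} {B : Matrix κ κ K} (hA : IsSemisimpleMatrix A)
    (hB : IsSemisimpleMatrix B) : IsSemisimpleMatrix (fromBlocks A 0 0 B) := by
  classical
  obtain ⟨p, hp0, hp, hpA⟩ := hA
  obtain ⟨q, hq0, hq, hqB⟩ := hB
  refine ⟨EuclideanDomain.lcm p q, ?_, ?_, ?_⟩
  · rw [Ne, EuclideanDomain.lcm_eq_zero_iff, not_or]
    exact ⟨hp0, hq0⟩
  · intro n x hx
    exact EuclideanDomain.lcm_dvd (hp n x ((EuclideanDomain.dvd_lcm_left p q).trans hx))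
      (hq n x ((EuclideanDomain.dvd_lcm_right p q).trans hx))
  · have hA' : aeval A (EuclideanDomain.lcm p q) = 0 :=
      aeval_eq_zero_of_dvd_aeval_eq_zero (EuclideanDomain.dvd_lcm_left p q) hpA
    have hB' : aeval B (EuclideanDomain.lcm p q) = 0 :=
      aeval_eq_zero_of_dvd_aeval_eq_zero (EuclideanDomain.dvd_lcm_right p q) hqB
    rw [aeval_fromBlocks, hA', hB', fromBlocks_zero]

theorem of_semiconj {A B N : Matrix ι ι K} (hA : IsSemisimpleMatrix A) (hN : N.det ≠ 0)
    (h : B * N = N * A) : IsSemisimpleMatrix B := by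
  obtain ⟨r, hr0, hr, hrA⟩ := hA
  refine ⟨r, hr0, hr, ?_⟩
  have key : ∀ p : K[X], aeval B p * N = N * aeval A p := fun p => by
    induction p using Polynomial.induction_on' with
    | add p q hp hq => rw [map_add, map_add, Matrix.add_mul, Matrix.mul_add, hp, hq]
    | monomial n a =>
      have hpow : B ^ n * N = N * A ^ n :=
        (SemiconjBy.pow_right (a := N) (x := A) (y := B) h.symm n).symm
      rw [aeval_monomial, aeval_monomial, ← Algebra.smul_def, ← Algebra.smul_def, Matrix.smul_mul,
        hpow, Matrix.mul_smul]
  have h1 := key r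
  rw [hrA, Matrix.mul_zero] at h1
  have h2 := congrArg (· * N⁻¹) h1
  simpa [Matrix.mul_assoc, mul_nonsing_inv _ hN.isUnit] using h2

theorem of_irreducible_charpoly {A : Matrix ι ι K} (h : Irreducible A.charpoly) :
    IsSemisimpleMatrix A :=
  ⟨A.charpoly, h.ne_zero, h.prime.isRadical, aeval_self_charpoly A⟩

theorem submatrix {A : Matrix ι ι K} (h : IsSemisimpleMatrix A) (e : κ ≃ ι) :
    IsSemisimpleMatrix (A.submatrix e e) := by
  obtain ⟨r, hr0, hr, hrA⟩ := h
  refine ⟨r, hr0, hr, ?_⟩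
  have : A.submatrix e e = reindexAlgEquiv K K e.symm A := rfl
  rw [this, aeval_algHom_apply, hrA, map_zero]

theorem isSemisimple_toLin' {A : Matrix ι ι K} (h : IsSemisimpleMatrix A) :
    Module.End.IsSemisimple (toLin' A) := by
  obtain ⟨r, hr0, hr, hrA⟩ := h
  refine Module.End.isSemisimple_of_squarefree_aeval_eq_zero (hr.squarefree hr0) ?_
  have : toLin' A = toLinAlgEquiv' A := rfl
  rw [this, aeval_algHom_apply, hrA, map_zero]

end IsSemisimpleMatrix

theorem charpoly_eq_of_semiconj {K : Type*} [Field K] {A B N : Matrix ι ι K} (hN : N.det ≠ 0)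
    (h : B * N = N * A) : B.charpoly = A.charpoly := by
  have hu : IsUnit N := (isUnit_iff_isUnit_det N).2 hN.isUnit
  have hB : B = N * A * N⁻¹ := by
    rw [← h, Matrix.mul_assoc, mul_nonsing_inv _ hN.isUnit, Matrix.mul_one]
  rw [hB]
  exact charpoly_units_conj hu.unit A

end Semisimple

section HasPair

theorem IsInvolutivePair.fromBlocks {ι κ : Type*} [Fintype ι] [DecidableEq ι] [Fintype κ]
    [DecidableEq κ] {G₁ T₁ : Matrix ι ι ℤ_[2]} {G₂ T₂ : Matrix κ κ ℤ_[2]}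
    (h₁ : IsInvolutivePair G₁ T₁) (h₂ : IsInvolutivePair G₂ T₂) :
    IsInvolutivePair (fromBlocks G₁ 0 0 G₂) (fromBlocks T₁ 0 0 T₂) where
  symm := IsSymm.fromBlocks h₁.symm (by simp) h₂.symm
  isom := by simp [fromBlocks_transpose, fromBlocks_multiply, h₁.isom, h₂.isom]
  det_ne := by
    rw [det_fromBlocks_zero₂₁]
    exact mul_ne_zero h₁.det_ne h₂.det_ne
  sq := by
    obtain ⟨W₁, hW₁⟩ := h₁.sq
    obtain ⟨W₂, hW₂⟩ := h₂.sq
    refine ⟨Matrix.fromBlocks W₁ 0 0 W₂, ?_⟩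
    rw [fromBlocks_multiply, fromBlocks_multiply, ← fromBlocks_one, sub_eq_add_neg, fromBlocks_neg,
      fromBlocks_add]
    simp [← hW₁, ← hW₂, sub_eq_add_neg]

theorem IsInvolutivePair.submatrix {ι κ : Type*} [Fintype ι] [DecidableEq ι] [Fintype κ]
    [DecidableEq κ] {G T : Matrix ι ι ℤ_[2]} (h : IsInvolutivePair G T) (e : κ ≃ ι) :
    IsInvolutivePair (G.submatrix e e) (T.submatrix e e) where
  symm := h.symm.submatrix e
  isom := by rw [transpose_submatrix, submatrix_mul_equiv, submatrix_mul_equiv, h.isom]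
  det_ne := by rw [det_submatrix_equiv_self]; exact h.det_ne
  sq := by
    obtain ⟨W, hW⟩ := h.sq
    refine ⟨W.submatrix e e, ?_⟩
    rw [submatrix_mul_equiv, submatrix_mul_equiv, ← hW, ← submatrix_one_equiv e]
    rfl

/-- `F` is the characteristic polynomial of a semisimple isometry `T` of an integral lattice with
determinant of valuation `d`, such that `T ^ 2` is trivial on the discriminant module. -/
def HasInvolutivePair (F : ℤ_[2][X]) (d : ℕ) : Prop :=
  ∃ (n : ℕ) (G T : Matrix (Fin n) (Fin n) ℤ_[2]), IsInvolutivePair G T ∧ G.det.valuation = d ∧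
    T.charpoly = F ∧ IsSemisimpleMatrix (T.map (PadicInt.Coe.ringHom : ℤ_[2] →+* ℚ_[2]))

theorem IsInvolutivePair.hasInvolutivePair {ι : Type*} [Fintype ι] [DecidableEq ι]
    {G T : Matrix ι ι ℤ_[2]} (h : IsInvolutivePair G T)
    (hT : IsSemisimpleMatrix (T.map (PadicInt.Coe.ringHom : ℤ_[2] →+* ℚ_[2]))) :
    HasInvolutivePair T.charpoly G.det.valuation := by
  let e := (Fintype.equivFin ι).symm
  refine ⟨_, _, _, h.submatrix e, by rw [det_submatrix_equiv_self], ?_, hT.submatrix e⟩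
  exact charpoly_reindex e.symm T

theorem HasInvolutivePair.mul {F₁ F₂ : ℤ_[2][X]} {d₁ d₂ : ℕ} (h₁ : HasInvolutivePair F₁ d₁)
    (h₂ : HasInvolutivePair F₂ d₂) : HasInvolutivePair (F₁ * F₂) (d₁ + d₂) := by
  obtain ⟨n₁, G₁, T₁, hp₁, rfl, rfl, hs₁⟩ := h₁
  obtain ⟨n₂, G₂, T₂, hp₂, rfl, rfl, hs₂⟩ := h₂
  have h := (hp₁.fromBlocks hp₂).hasInvolutivePair (by
    rw [fromBlocks_map]
    convert hs₁.fromBlocks hs₂ using 2 <;> ext i j <;> simp)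
  rwa [charpoly_fromBlocks_zero₂₁, det_fromBlocks_zero₂₁,
    PadicInt.valuation_mul hp₁.det_ne hp₂.det_ne] at h

theorem HasInvolutivePair.hasSemisimpleIsometry {F : ℤ_[2][X]} {d : ℕ}
    (h : HasInvolutivePair F d) (hd : Even d) : HasSemisimpleIsometryUnimodularPadic 2 F := by
  obtain ⟨n, G, T, hp, rfl, hF, hs⟩ := h
  obtain ⟨G', T', N, hp', hu, hN, hTN⟩ := hp.exists_unimodular hd
  have hn : n = F.natDegree := by rw [← hF, charpoly_natDegree_eq_dim, Fintype.card_fin]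
  subst hn
  have hN' : (N.map (PadicInt.Coe.ringHom : ℤ_[2] →+* ℚ_[2])).det ≠ 0 := by
    rw [← RingHom.mapMatrix_apply, ← RingHom.map_det]
    exact fun h0 => hN (Subtype.ext h0)
  have hTN' : T'.map (PadicInt.Coe.ringHom : ℤ_[2] →+* ℚ_[2]) * N.map PadicInt.Coe.ringHom =
      N.map PadicInt.Coe.ringHom * T.map PadicInt.Coe.ringHom := by
    rw [← Matrix.map_mul, ← Matrix.map_mul, hTN]
  refine ⟨G', T', hp'.symm, hu, isUnit_det_of_isom hp'.det_ne hp'.isom, hp'.isom,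
    (hs.of_semiconj hN' hTN').isSemisimple_toLin', ?_⟩
  rw [charpoly_eq_of_semiconj hN' hTN', charpoly_map, hF]

end HasPair

section BaseCases

theorem isSemisimpleMatrix_of_charpoly {ι : Type*} [Fintype ι] [DecidableEq ι]
    {T : Matrix ι ι ℤ_[2]} (h : Irreducible T.charpoly) :
    IsSemisimpleMatrix (T.map (PadicInt.Coe.ringHom : ℤ_[2] →+* ℚ_[2])) := by
  apply IsSemisimpleMatrix.of_irreducible_charpoly
  rw [charpoly_map]
  exact (Monic.irreducible_iff_irreducible_map_fraction_map (K := ℚ_[2])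
    (charpoly_monic T)).1 h

theorem hasInvolutivePair_one : HasInvolutivePair 1 0 := by
  have hp : IsInvolutivePair (1 : Matrix (Fin 0) (Fin 0) ℤ_[2]) 1 :=
    ⟨isSymm_one, by simp, by simp, ⟨0, by simp⟩⟩
  have h := hp.hasInvolutivePair ⟨1, one_ne_zero, isUnit_one.squarefree.isRadical,
    Subsingleton.elim _ _⟩
  simpa [charpoly] using h

theorem hasInvolutivePair_X_sub_C {t g : ℤ_[2]} (ht : t * t = 1) (hg : g ≠ 0) :
    HasInvolutivePair (X - C t) g.valuation := by
  have hp : IsInvolutivePair !![g] !![t] :=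
    ⟨by ext i j; fin_cases i; fin_cases j; rfl,
      by
        ext i j
        fin_cases i
        fin_cases j
        simp [Matrix.mul_apply]
        linear_combination g * ht,
      by simpa using hg,
      ⟨0, by ext i j; fin_cases i; fin_cases j; simp [Matrix.mul_apply, ht]⟩⟩
  have hc : (!![t] : Matrix (Fin 1) (Fin 1) ℤ_[2]).charpoly = X - C t := by
    simp [charpoly, charmatrix]
  have h := hp.hasInvolutivePair (isSemisimpleMatrix_of_charpoly (by
    rw [hc]; exact irreducible_X_sub_C t))
  rwa [hc, det_fin_one] at h

theorem minpoly_root_eq {R : Type*} [CommRing R] [IsDomain R] {g : R[X]} (hg : g.Monic) :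
    minpoly R (AdjoinRoot.root g) = g := by
  rcases subsingleton_or_nontrivial (AdjoinRoot g) with hs | hs
  · have h1 : g ∣ 1 := AdjoinRoot.mk_eq_zero.1 (Subsingleton.elim _ _)
    have h2 := hg.eq_one_of_isUnit (isUnit_of_dvd_one h1)
    rw [h2] at hs ⊢
    exact minpoly.subsingleton _ _
  have hi : IsIntegral R (AdjoinRoot.root g) := ⟨g, hg, AdjoinRoot.eval₂_root g⟩
  have hd : g ∣ minpoly R (AdjoinRoot.root g) := by
    rw [← AdjoinRoot.mk_eq_zero, ← AdjoinRoot.aeval_eq]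
    exact minpoly.aeval _ _
  refine eq_of_monic_of_dvd_of_natDegree_le hg (minpoly.monic hi) hd ?_
  exact natDegree_le_natDegree (minpoly.min R _ hg (by simp [AdjoinRoot.aeval_eq]))

theorem charpoly_leftMulMatrix_root {R : Type*} [CommRing R] [IsDomain R] {g : R[X]}
    (hg : g.Monic) : (Algebra.leftMulMatrix (AdjoinRoot.powerBasis' hg).basis
      (AdjoinRoot.root g)).charpoly = g := by
  have h := charpoly_leftMulMatrix (AdjoinRoot.powerBasis' hg)
  rw [AdjoinRoot.powerBasis'_gen] at h
  rw [h, minpoly_root_eq hg]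

theorem hasInvolutivePair_mul_of_reverse {g h : ℤ_[2][X]} (hg : g.Monic) (hgi : Irreducible g)
    (hhi : Irreducible h) (hu : IsUnit (g.coeff 0)) (hh : C (g.coeff 0) * h = g.reverse) :
    HasInvolutivePair (g * h) 0 := by
  set A := Algebra.leftMulMatrix (AdjoinRoot.powerBasis' hg).basis (AdjoinRoot.root g) with hA
  have hAc : A.charpoly = g := charpoly_leftMulMatrix_root hg
  have hdet := det_eq_sign_charpoly_coeff A
  rw [hAc] at hdet
  have hAu : IsUnit A.det := by
    rw [hdet]
    exact ((isUnit_one.neg).pow _).mul hu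
  have hinv : (A⁻¹)ᵀ.charpoly = h := by
    rw [charpoly_transpose, charpoly_inv _ ((isUnit_iff_isUnit_det A).2 hAu), ← reverse_charpoly,
      hAc, ← hh]
    have h1 : Ring.inverse A.det * A.det = 1 := Ring.inverse_mul_cancel _ hAu
    have h2 : (C (Ring.inverse A.det) * C A.det : ℤ_[2][X]) = 1 := by rw [← C_mul, h1, C_1]
    rw [hdet, C_mul, C_pow, C_neg, C_1, ← hdet] at h2
    linear_combination h * h2
  have hGu : IsUnit (fromBlocks 0 1 1 0 :
      Matrix (Fin (AdjoinRoot.powerBasis' hg).dim ⊕ Fin (AdjoinRoot.powerBasis' hg).dim)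
        (Fin (AdjoinRoot.powerBasis' hg).dim ⊕ Fin (AdjoinRoot.powerBasis' hg).dim)
        ℤ_[2]).det := by
    refine isUnit_det_of_right_inverse (B := fromBlocks 0 1 1 0) ?_
    simp [fromBlocks_multiply]
  have hp : IsInvolutivePair (fromBlocks 0 1 1 0) (fromBlocks A 0 0 (A⁻¹)ᵀ) :=
    { symm := IsSymm.fromBlocks isSymm_zero (by simp) isSymm_zero
      isom := by
        have h1 := congrArg transpose (nonsing_inv_mul A hAu)
        rw [transpose_mul, transpose_one] at h1
        simp [fromBlocks_transpose, fromBlocks_multiply, nonsing_inv_mul _ hAu, h1]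
      det_ne := hGu.ne_zero
      sq := by
        refine ⟨(fromBlocks A 0 0 (A⁻¹)ᵀ * fromBlocks A 0 0 (A⁻¹)ᵀ - 1) * fromBlocks 0 1 1 0, ?_⟩
        rw [Matrix.mul_assoc]
        simp [fromBlocks_multiply] }
  have hs := IsSemisimpleMatrix.fromBlocks
    (isSemisimpleMatrix_of_charpoly (T := A) (by rwa [hAc]))
    (isSemisimpleMatrix_of_charpoly (T := (A⁻¹)ᵀ) (by rwa [hinv]))
  have hres := hp.hasInvolutivePair (by
    rw [fromBlocks_map]
    convert hs using 2 <;> ext i j <;> simp)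
  rwa [charpoly_fromBlocks_zero₂₁, hAc, hinv, valuation_eq_zero_of_isUnit hGu] at hres

end BaseCases

section Core

variable {R S ι : Type*} [CommRing R] [CommRing S] [Algebra R S] [Fintype ι] [DecidableEq ι]

/-- The Gram matrix of the sesquilinear form `(x, y) ↦ φ (σ x * y)`. -/
noncomputable def sesqGram (b : Module.Basis ι R S) (φ : S →ₗ[R] R) (σ : S →ₐ[R] S) : Matrix ι ι R :=
  of fun i j => φ (σ (b i) * b j)

theorem sesqGram_mul_leftMulMatrix (b : Module.Basis ι R S) (φ : S →ₗ[R] R) (σ : S →ₐ[R] S)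
    (x : S) :
    sesqGram b φ σ * Algebra.leftMulMatrix b x = of fun i j => φ (σ (b i) * (x * b j)) := by
  ext i j
  simp only [sesqGram, Matrix.mul_apply, of_apply, Algebra.leftMulMatrix_eq_repr_mul]
  conv_rhs => rw [← b.sum_repr (x * b j), Finset.mul_sum, map_sum]
  refine Finset.sum_congr rfl fun k _ => ?_
  rw [mul_smul_comm, map_smul, smul_eq_mul, mul_comm]

theorem leftMulMatrix_transpose_mul_sesqGram (b : Module.Basis ι R S) (φ : S →ₗ[R] R)
    (σ : S →ₐ[R] S) (x : S) :
    (Algebra.leftMulMatrix b x)ᵀ * sesqGram b φ σ =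
      sesqGram b φ σ * Algebra.leftMulMatrix b (σ x) := by
  rw [sesqGram_mul_leftMulMatrix]
  ext i j
  simp only [sesqGram, Matrix.mul_apply, of_apply, transpose_apply,
    Algebra.leftMulMatrix_eq_repr_mul]
  rw [← mul_assoc, mul_comm (σ (b i)), ← map_mul]
  conv_rhs => rw [← b.sum_repr (x * b i), map_sum, Finset.sum_mul, map_sum]
  refine Finset.sum_congr rfl fun k _ => ?_
  rw [map_smul, smul_mul_assoc, map_smul, smul_eq_mul]

theorem hasInvolutivePair_of_sesqGram [Algebra ℤ_[2] S] (b : Module.Basis ι ℤ_[2] S)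
    {φ : S →ₗ[ℤ_[2]] ℤ_[2]} {σ : S →ₐ[ℤ_[2]] S} (hσ : ∀ x, σ (σ x) = x)
    (hφ : ∀ x, φ (σ x) = -φ x) {α : S} (hα : α * σ α = 1) (hP : IsUnit (sesqGram b φ σ).det)
    {f : ℤ_[2][X]} (hf : (Algebra.leftMulMatrix b α).charpoly = f) (hi : Irreducible f)
    (h0 : f.eval 1 * f.eval (-1) ≠ 0) :
    HasInvolutivePair f (f.eval 1 * f.eval (-1)).valuation := by
  set P := sesqGram b φ σ with hPdef
  set M := Algebra.leftMulMatrix b with hM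
  have hT : ∀ x, (M x)ᵀ * P = P * M (σ x) := leftMulMatrix_transpose_mul_sesqGram b φ σ
  have hPt : Pᵀ = -P := by
    ext i j
    simp only [hPdef, sesqGram, transpose_apply, of_apply, Matrix.neg_apply, ← hφ, map_mul, hσ]
    rw [mul_comm]
  have hsq : M α * M α - 1 = M α * M (α - σ α) := by
    rw [← map_mul, ← map_mul, mul_sub, hα, map_sub, map_one]
  have hdet : f.eval 1 * f.eval (-1) = (M α).det * (M (α - σ α)).det := by
    rw [← det_mul, ← hsq, ← hf, eval_charpoly, eval_charpoly, ← det_mul]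
    congr 1
    rw [map_neg, map_one]
    noncomm_ring
  have hαu : IsUnit (M α).det := by
    refine isUnit_det_of_right_inverse (B := M (σ α)) ?_
    rw [← map_mul, hα, map_one]
  have hδ : (M (α - σ α)).det ≠ 0 := by
    rw [hdet] at h0
    exact right_ne_zero_of_mul h0
  have hp : IsInvolutivePair (P * M (α - σ α)) (M α) :=
    { symm := by
        rw [IsSymm, transpose_mul, hPt, Matrix.mul_neg, hT, map_sub σ, hσ, ← Matrix.mul_neg,
          ← map_neg, neg_sub]
      isom := by
        rw [← Matrix.mul_assoc, hT, Matrix.mul_assoc, Matrix.mul_assoc, ← map_mul, ← map_mul]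
        congr 2
        linear_combination (α - σ α) * hα
      det_ne := by
        rw [det_mul]
        exact mul_ne_zero hP.ne_zero hδ
      sq := by
        refine ⟨M α * P⁻¹, ?_⟩
        rw [hsq, Matrix.mul_assoc, ← Matrix.mul_assoc P⁻¹, nonsing_inv_mul _ hP, Matrix.one_mul] }
  have h := hp.hasInvolutivePair (isSemisimpleMatrix_of_charpoly (by rwa [hf]))
  rw [hf, det_mul, PadicInt.valuation_mul hP.ne_zero hδ, valuation_eq_zero_of_isUnit hP] at h
  rwa [hdet, PadicInt.valuation_mul hαu.ne_zero hδ, valuation_eq_zero_of_isUnit hαu]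

end Core

section SymmetricRoot

open AdjoinRoot

variable {R : Type*} [CommRing R]

theorem exists_root_involution {f : R[X]} (hf : f.Monic) (hr : f.reverse = f) :
    ∃ σ : AdjoinRoot f →ₐ[R] AdjoinRoot f, σ (root f) = -aeval (root f) f.divX ∧
      root f * σ (root f) = 1 ∧ ∀ x, σ (σ x) = x := by
  have hc : f.coeff 0 = 1 := by rw [← hr, coeff_zero_reverse, hf]
  set α := root f with hα
  set β : AdjoinRoot f := -aeval α f.divX with hβ
  have hf0 : aeval α f = 0 := by rw [hα, aeval_eq, mk_self]
  have h1 : α * β = 1 := by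
    have h := congrArg (aeval α) (divX_mul_X_add f)
    rw [map_add, map_mul, aeval_X, hc, C_1, map_one, hf0] at h
    rw [hβ]
    linear_combination -h
  have hβ0 : aeval β f = 0 := by
    let _ : Invertible α := ⟨β, by rw [mul_comm, h1], h1⟩
    have h := (eval₂_reverse_eq_zero_iff (algebraMap R (AdjoinRoot f)) α f).2 hf0
    rwa [hr] at h
  let σ : AdjoinRoot f →ₐ[R] AdjoinRoot f := liftAlgHom f (Algebra.ofId R _) β hβ0
  have hσ : σ α = β := liftAlgHom_root ..
  have hσβ : σ β = α := by
    have h := congrArg σ h1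
    rw [map_mul, map_one, hσ] at h
    calc σ β = (α * β) * σ β := by rw [h1, one_mul]
      _ = α * (β * σ β) := mul_assoc _ _ _
      _ = α := by rw [h, mul_one]
  refine ⟨σ, hσ, by rw [hσ, h1], fun x => ?_⟩
  have : σ.comp σ = AlgHom.id R _ := by
    ext
    change σ (σ α) = α
    rw [hσ, hσβ]
  exact DFunLike.congr_fun this x

/-- The coordinate of the top power of the root of `f`. -/
noncomputable def topCoord {f : R[X]} (hf : f.Monic) : AdjoinRoot f →ₗ[R] R :=
  (lcoeff R (f.natDegree - 1)).comp (modByMonicHom hf)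

theorem topCoord_aeval {f : R[X]} (hf : f.Monic) {p : R[X]} (hp : p.degree < f.degree) :
    topCoord hf (aeval (root f) p) = p.coeff (f.natDegree - 1) := by
  nontriviality R
  rw [topCoord, LinearMap.comp_apply, aeval_eq, modByMonicHom_mk,
    (modByMonic_eq_self_iff hf).2 hp, lcoeff_apply]

theorem topCoord_root_pow {f : R[X]} (hf : f.Monic) {j : ℕ} (hj : j < f.natDegree) :
    topCoord hf (root f ^ j) = if j = f.natDegree - 1 then 1 else 0 := by
  nontriviality R
  have h := topCoord_aeval hf (p := X ^ j) (by
    rw [degree_X_pow, degree_eq_natDegree hf.ne_zero]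
    exact_mod_cast hj)
  rw [map_pow, aeval_X] at h
  rw [h, coeff_X_pow]
  simp only [eq_comm]

theorem topCoord_aeval_divX {f : R[X]} (hf : f.Monic) (h0 : 0 < f.natDegree) :
    topCoord hf (aeval (root f) f.divX) = 1 := by
  nontriviality R
  rw [topCoord_aeval hf (degree_divX_lt hf.ne_zero), coeff_divX, Nat.sub_add_cancel h0]
  exact hf

theorem exists_pairing {f : R[X]} (hf : f.Monic) (hr : f.reverse = f) {n : ℕ} (hn : 0 < n)
    (hd : f.natDegree = 2 * n) :
    ∃ (φ : AdjoinRoot f →ₗ[R] R) (σ : AdjoinRoot f →ₐ[R] AdjoinRoot f),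
      (∀ x, σ (σ x) = x) ∧ (∀ x, φ (σ x) = -φ x) ∧ root f * σ (root f) = 1 ∧
        IsUnit (sesqGram (powerBasis' hf).basis φ σ).det := by
  obtain ⟨σ, hσβ, hσ1, hσσ⟩ := exists_root_involution hf hr
  set α := root f with hα
  set β := σ α with hβ
  set b := (powerBasis' hf).basis with hb
  have hbα : ∀ i, b i = α ^ (i : ℕ) := fun i => by
    rw [hb, PowerBasis.basis_eq_pow, powerBasis'_gen]
  have hdim : (powerBasis' hf).dim = 2 * n := by rw [powerBasis'_dim, hd]
  have hpow : ∀ i k, α ^ (i + k) * β ^ k = α ^ i := fun i k => by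
    rw [pow_add, mul_assoc, ← mul_pow, hσ1, one_pow, mul_one]
  have htop : topCoord hf β = -1 := by
    rw [hσβ, map_neg, topCoord_aeval_divX hf (by omega)]
  have hswap : ∀ y, topCoord hf (α ^ (2 * n - 2) * σ y) = -topCoord hf y := fun y => by
    have : (topCoord hf).comp ((LinearMap.mulLeft R (α ^ (2 * n - 2))).comp σ.toLinearMap) =
        -topCoord hf := by
      refine b.ext fun j => ?_
      have hj : (j : ℕ) < 2 * n := hdim ▸ j.2
      simp only [LinearMap.comp_apply, LinearMap.mulLeft_apply, AlgHom.toLinearMap_apply, hbα,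
        map_pow, LinearMap.neg_apply]
      rw [topCoord_root_pow hf (by omega), hd]
      split_ifs with h
      · rw [← htop, h, ← hβ]
        congr 1
        have h1 := hpow 0 (2 * n - 2)
        rw [zero_add, pow_zero] at h1
        rw [show 2 * n - 1 = 2 * n - 2 + 1 by omega, pow_succ, ← mul_assoc, h1, one_mul]
      · rw [← hβ, show 2 * n - 2 = (2 * n - 2 - j) + j by omega, hpow,
          topCoord_root_pow hf (by omega), if_neg (by omega), neg_zero]
    exact LinearMap.congr_fun this y
  refine ⟨(topCoord hf).comp (LinearMap.mulLeft R (α ^ (n - 1))), σ, hσσ, fun x => ?_, hσ1, ?_⟩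
  · simp only [LinearMap.comp_apply, LinearMap.mulLeft_apply]
    rw [← hswap, map_mul σ, map_pow σ, ← hβ, ← mul_assoc,
      show 2 * n - 2 = (n - 1) + (n - 1) by omega, hpow]
  · have hP : (sesqGram b ((topCoord hf).comp (LinearMap.mulLeft R (α ^ (n - 1)))) σ *
        Algebra.leftMulMatrix b (α ^ n)).det = 1 := by
      have hentry : ∀ i j : Fin (powerBasis' hf).dim, j ≤ i →
          (sesqGram b ((topCoord hf).comp (LinearMap.mulLeft R (α ^ (n - 1)))) σ *
            Algebra.leftMulMatrix b (α ^ n)) i j = if i = j then 1 else 0 := by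
        intro i j hij
        have hi : (i : ℕ) < 2 * n := hdim ▸ i.2
        have hij' : (j : ℕ) ≤ i := hij
        rw [sesqGram_mul_leftMulMatrix]
        simp only [of_apply, LinearMap.comp_apply, LinearMap.mulLeft_apply, hbα, map_pow, ← hβ]
        have h1 : α ^ (n - 1) * (β ^ (i : ℕ) * (α ^ n * α ^ (j : ℕ))) =
            α ^ (2 * n - 1 + j - i) := by
          rw [← hpow (2 * n - 1 + j - i) i,
            show 2 * n - 1 + j - i + i = (n - 1) + n + j by omega, pow_add, pow_add]
          ring
        rw [h1, topCoord_root_pow hf (by omega), hd]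
        simp only [Fin.ext_iff]
        congr 1
        exact propext (by omega)
      rw [det_of_isUpperTriangular]
      · exact Finset.prod_eq_one fun i _ => by rw [hentry i i le_rfl, if_pos rfl]
      · intro i j hij
        rw [hentry i j (le_of_lt hij), if_neg (ne_of_gt (show j < i from hij))]
    rw [det_mul] at hP
    exact IsUnit.of_mul_eq_one _ hP

theorem hasInvolutivePair_of_reverse_eq {f : ℤ_[2][X]} (hf : f.Monic) (hi : Irreducible f)
    (hr : f.reverse = f) (hd : Even f.natDegree) (h0 : f.eval 1 * f.eval (-1) ≠ 0) :
    HasInvolutivePair f (f.eval 1 * f.eval (-1)).valuation := by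
  obtain ⟨n, hn⟩ := hd
  have hpos : 0 < f.natDegree := by
    rw [Nat.pos_iff_ne_zero]
    intro h
    rw [eq_one_of_monic_natDegree_zero hf h] at hi
    exact hi.not_isUnit isUnit_one
  obtain ⟨φ, σ, hσ, hφ, hα, hP⟩ := exists_pairing hf hr (n := n) (by omega) (by omega)
  exact hasInvolutivePair_of_sesqGram _ hσ hφ hα hP (charpoly_leftMulMatrix_root hf) hi h0

end SymmetricRoot

section Decomposition

variable {R : Type*} [CommRing R]

theorem reverse_eq_mirror {p : R[X]} (h : p.coeff 0 ≠ 0) : p.reverse = p.mirror := by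
  rw [mirror, natTrailingDegree_eq_zero_of_constantCoeff_ne_zero h, pow_zero, mul_one]

theorem eval_neg_one_reverse (p : R[X]) :
    p.reverse.eval (-1) * (-1) ^ p.natDegree = p.eval (-1) := by
  let _ : Invertible (-1 : R) := ⟨-1, by simp, by simp⟩
  exact eval₂_reverse_mul_pow (RingHom.id R) (-1) p

theorem eval_one_reverse (p : R[X]) : p.reverse.eval 1 = p.eval 1 := by
  let _ : Invertible (1 : R) := invertibleOne
  have h := eval₂_reverse_mul_pow (RingHom.id R) 1 p
  simpa [eval₂_id] using h

theorem IsSymmPoly.coeff_zero_mul_self {F : R[X]} (h : IsSymmPoly F) (hF : F.Monic) :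
    F.coeff 0 * F.coeff 0 = 1 := by
  have h1 := congrArg (coeff · 0) h
  simp only [coeff_C_mul, coeff_zero_reverse] at h1
  rw [← h1]
  exact hF

theorem reverse_reverse_of_coeff_zero_ne {p : R[X]} (h : p.coeff 0 ≠ 0) :
    p.reverse.reverse = p := by
  have hp : p ≠ 0 := fun h0 => h (by rw [h0, coeff_zero])
  have h1 : p.reverse.coeff 0 ≠ 0 := by
    rw [coeff_zero_reverse]
    exact leadingCoeff_ne_zero.2 hp
  rw [reverse_eq_mirror h1, reverse_eq_mirror h, mirror_mirror]

variable [IsDomain R]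

theorem isUnit_reverse {p : R[X]} (h : IsUnit p) : IsUnit p.reverse := by
  obtain ⟨q, hq⟩ := h.exists_right_inv
  refine IsUnit.of_mul_eq_one q.reverse ?_
  rw [← reverse_mul_of_domain, hq, ← C_1, reverse_C]

theorem irreducible_reverse {p : R[X]} (h : Irreducible p) (h0 : p.coeff 0 ≠ 0) :
    Irreducible p.reverse := by
  have hrr := reverse_reverse_of_coeff_zero_ne h0
  refine ⟨fun hu => h.not_isUnit (hrr ▸ isUnit_reverse hu), fun a b hab => ?_⟩
  have hc : a.coeff 0 * b.coeff 0 ≠ 0 := by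
    rw [← mul_coeff_zero, ← hab, coeff_zero_reverse]
    exact leadingCoeff_ne_zero.2 h.ne_zero
  rw [hab, reverse_mul_of_domain] at hrr
  refine (h.isUnit_or_isUnit hrr.symm).imp (fun hu => ?_) (fun hu => ?_)
  · rw [← reverse_reverse_of_coeff_zero_ne (left_ne_zero_of_mul hc)]
    exact isUnit_reverse hu
  · rw [← reverse_reverse_of_coeff_zero_ne (right_ne_zero_of_mul hc)]
    exact isUnit_reverse hu

namespace IsSymmPoly

theorem of_mul_left {P Q : R[X]} (h : IsSymmPoly (P * Q)) (hP : IsSymmPoly P) (hPm : P.Monic) :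
    IsSymmPoly Q := by
  have h0 : C (P.coeff 0) * P ≠ 0 := by
    refine mul_ne_zero ?_ hPm.ne_zero
    rw [C_ne_zero]
    exact left_ne_zero_of_mul_eq_one (hP.coeff_zero_mul_self hPm)
  unfold IsSymmPoly at *
  rw [reverse_mul_of_domain, hP, mul_coeff_zero, C_mul] at h
  refine mul_left_cancel₀ h0 ?_
  linear_combination h

theorem X_sub_C {t : R} (ht : t * t = 1) : IsSymmPoly (X - C t) := by
  have h1 : (X : R[X]).reverse = 1 := by
    rw [← one_mul X, reverse_mul_X, ← C_1, reverse_C]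
  have h2 : (C t * C t : R[X]) = 1 := by rw [← C_mul, ht, C_1]
  rw [IsSymmPoly, sub_eq_add_neg, ← C_neg, reverse_add_C, h1, natDegree_X, pow_one, coeff_add,
    coeff_X_zero, coeff_C_zero, zero_add, C_neg]
  linear_combination -h2

theorem coeff_zero_eq_one {F : R[X]} (h : IsSymmPoly F) (h1 : F.eval 1 ≠ 0) :
    F.coeff 0 = 1 := by
  have h2 := congrArg (eval 1) h
  rw [eval_one_reverse, eval_mul, eval_C] at h2
  exact mul_right_cancel₀ h1 (by rw [← h2, one_mul])

theorem reverse_eq {F : R[X]} (h : IsSymmPoly F) (h1 : F.eval 1 ≠ 0) : F.reverse = F := by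
  rw [h, h.coeff_zero_eq_one h1, C_1, one_mul]

theorem even_natDegree {F : R[X]} (h : IsSymmPoly F) (h1 : F.eval 1 ≠ 0) (h2 : F.eval (-1) ≠ 0)
    (hR : (2 : R) ≠ 0) : Even F.natDegree := by
  have h3 := eval_neg_one_reverse F
  rw [h.reverse_eq h1] at h3
  by_contra hodd
  rw [Nat.not_even_iff_odd] at hodd
  rw [hodd.neg_one_pow] at h3
  have h4 : 2 * F.eval (-1) = 0 := by linear_combination -h3
  exact (mul_ne_zero hR h2) h4

end IsSymmPoly

theorem Polynomial.Monic.exists_monic_irreducible_dvd [UniqueFactorizationMonoid R] {F : R[X]}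
    (hF : F.Monic) (hd : F.natDegree ≠ 0) : ∃ g : R[X], g.Monic ∧ Irreducible g ∧ g ∣ F := by
  have hu : ¬ IsUnit F := fun h => hd (by rw [hF.eq_one_of_isUnit h, natDegree_one])
  obtain ⟨g, hg, q, hq⟩ := WfDvdMonoid.exists_irreducible_factor hu hF.ne_zero
  have h1 : g.leadingCoeff * q.leadingCoeff = 1 := by rw [← leadingCoeff_mul, ← hq, hF]
  have hunit : IsUnit (C q.leadingCoeff) :=
    isUnit_C.2 (IsUnit.of_mul_eq_one _ (by rw [mul_comm, h1]))
  have ha : Associated g (g * C q.leadingCoeff) := ⟨hunit.unit, rfl⟩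
  refine ⟨g * C q.leadingCoeff, ?_, ha.irreducible hg, ha.dvd_iff_dvd_left.1 ⟨q, hq⟩⟩
  rw [Monic, leadingCoeff_mul, leadingCoeff_C, h1]

end Decomposition

section Induction

theorem exists_symmetric_factor {F : ℤ_[2][X]} (hF : F.Monic) (hs : IsSymmPoly F)
    (hd : F.natDegree ≠ 0) (h0 : F.eval 1 * F.eval (-1) ≠ 0) :
    ∃ (A : ℤ_[2][X]) (d : ℕ), A.Monic ∧ IsSymmPoly A ∧ A ∣ F ∧ A.natDegree ≠ 0 ∧
      HasInvolutivePair A d ∧ d ≡ (A.eval 1 * A.eval (-1)).valuation [MOD 2] := by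
  obtain ⟨g, hg, hgi, hgF⟩ := hF.exists_monic_irreducible_dvd hd
  have hgd : g.natDegree ≠ 0 := fun h =>
    hgi.not_isUnit (by rw [eq_one_of_monic_natDegree_zero hg h]; exact isUnit_one)
  have hF0 := hs.coeff_zero_mul_self hF
  obtain ⟨v, hv⟩ : ∃ v, g.coeff 0 * v = 1 := by
    obtain ⟨q, hq⟩ := hgF
    refine ⟨q.coeff 0 * F.coeff 0, ?_⟩
    rw [← mul_assoc, ← mul_coeff_zero, ← hq, hF0]
  have hgu : IsUnit (g.coeff 0) := IsUnit.of_mul_eq_one _ hv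
  have hCv : (C (g.coeff 0) * C v : ℤ_[2][X]) = 1 := by rw [← C_mul, hv, C_1]
  have hgrr := reverse_reverse_of_coeff_zero_ne hgu.ne_zero
  set h : ℤ_[2][X] := C v * g.reverse with hh
  have hhg : C (g.coeff 0) * h = g.reverse := by rw [hh, ← mul_assoc, hCv, one_mul]
  have hassoc : Associated g.reverse h :=
    ⟨⟨C v, C (g.coeff 0), by rw [mul_comm, hCv], hCv⟩, by rw [hh, mul_comm]⟩
  have hhi : Irreducible h := hassoc.irreducible (irreducible_reverse hgi hgu.ne_zero)
  have hgr : g.reverse.leadingCoeff = g.coeff 0 := by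
    rw [reverse_leadingCoeff, trailingCoeff,
      natTrailingDegree_eq_zero_of_constantCoeff_ne_zero hgu.ne_zero]
  have hhm : h.Monic := by
    rw [Monic, hh, leadingCoeff_mul, leadingCoeff_C, hgr, mul_comm, hv]
  have hg1 : g.eval 1 * g.eval (-1) ≠ 0 := by
    obtain ⟨q, hq⟩ := hgF
    intro h1
    refine h0 ?_
    rw [hq, eval_mul, eval_mul]
    linear_combination q.eval 1 * q.eval (-1) * h1
  by_cases heq : h = g
  · have hgs : IsSymmPoly g := by rw [IsSymmPoly, ← hhg, heq]
    refine ⟨g, _, hg, hgs, hgF, hgd, hasInvolutivePair_of_reverse_eq hg hgi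
      (hgs.reverse_eq (left_ne_zero_of_mul hg1))
      (hgs.even_natDegree (left_ne_zero_of_mul hg1) (right_ne_zero_of_mul hg1) two_ne_zero) hg1,
      Nat.ModEq.refl _⟩
  · have hhF : h ∣ F := by
      rw [← hassoc.dvd_iff_dvd_left]
      obtain ⟨q, hq⟩ := hgF
      refine ⟨C (F.coeff 0) * q.reverse, ?_⟩
      have h1 : C (F.coeff 0) * C (F.coeff 0) = (1 : ℤ_[2][X]) := by rw [← C_mul, hF0, C_1]
      have h2 := hs
      rw [IsSymmPoly] at h2
      nth_rewrite 1 [hq] at h2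
      rw [reverse_mul_of_domain] at h2
      linear_combination -F * h1 - C (F.coeff 0) * h2
    have hghF : g * h ∣ F := by
      obtain ⟨q, hq⟩ := hgF
      have hng : ¬ h ∣ g := fun hdvd =>
        heq (eq_of_monic_of_associated hhm hg (hhi.associated_of_dvd hgi hdvd))
      have h1 : h ∣ q := (hhi.prime.dvd_or_dvd (hq ▸ hhF)).resolve_left hng
      rw [hq]
      exact mul_dvd_mul_left g h1
    have hsymm : IsSymmPoly (g * h) := by
      have h1 : h.reverse = C v * g := by rw [hh, reverse_mul_of_domain, reverse_C, hgrr]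
      have h2 : h.coeff 0 = v := by rw [hh, coeff_C_mul, coeff_zero_reverse, hg, mul_one]
      rw [IsSymmPoly, reverse_mul_of_domain, h1, ← hhg, mul_coeff_zero, h2, C_mul]
      ring
    refine ⟨g * h, 0, hg.mul hhm, hsymm, hghF, ?_, hasInvolutivePair_mul_of_reverse hg hgi hhi hgu
      hhg, ?_⟩
    · rw [hg.natDegree_mul hhm]
      omega
    · have hvu : IsUnit v := IsUnit.of_mul_eq_one _ (by rw [mul_comm, hv])
      set w := v * v * (-1) ^ g.natDegree with hw
      have hwu : IsUnit w := (hvu.mul hvu).mul (isUnit_one.neg.pow _)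
      have h1 : (g * h).eval 1 * (g * h).eval (-1) =
          w * ((g.eval 1 * g.eval (-1)) * (g.eval 1 * g.eval (-1))) := by
        have h3 : ((-1 : ℤ_[2]) ^ g.natDegree) * (-1) ^ g.natDegree = 1 := by
          rw [← mul_pow]; simp
        have h2 : g.reverse.eval (-1) = (-1) ^ g.natDegree * g.eval (-1) := by
          rw [← eval_neg_one_reverse g]
          linear_combination -g.reverse.eval (-1) * h3
        rw [hh, eval_mul, eval_mul, eval_mul, eval_mul, eval_C, eval_C, eval_one_reverse, h2, hw]
        ring
      rw [h1, PadicInt.valuation_mul hwu.ne_zero (mul_ne_zero hg1 hg1),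
        PadicInt.valuation_mul hg1 hg1, valuation_eq_zero_of_isUnit hwu, zero_add, Nat.ModEq]
      omega

theorem exists_hasInvolutivePair (N : ℕ) : ∀ F : ℤ_[2][X], F.natDegree = N → F.Monic →
    IsSymmPoly F → ∀ e : ℕ,
      (F.eval 1 * F.eval (-1) = 0 ∨ (F.eval 1 * F.eval (-1)).valuation ≡ e [MOD 2]) →
      ∃ d, d ≡ e [MOD 2] ∧ HasInvolutivePair F d := by
  induction N using Nat.strong_induction_on with
  | _ N ih =>
  intro F hN hF hs e he
  by_cases hd : F.natDegree = 0
  · rw [eq_one_of_monic_natDegree_zero hF hd] at he ⊢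
    refine ⟨0, ?_, hasInvolutivePair_one⟩
    simpa using he
  have hquot : ∀ A : ℤ_[2][X], A.Monic → IsSymmPoly A → A.natDegree ≠ 0 → A ∣ F →
      ∃ Q d, F = A * Q ∧ HasInvolutivePair Q d ∧
        d ≡ (Q.eval 1 * Q.eval (-1)).valuation [MOD 2] := by
    rintro A hA hAs hAd ⟨Q, rfl⟩
    have hQ : Q.Monic := hA.of_mul_monic_left hF
    rw [hA.natDegree_mul hQ] at hN
    obtain ⟨d, hd1, hd2⟩ := ih Q.natDegree (by omega) Q rfl hQ (hs.of_mul_left hAs hA)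
      (Q.eval 1 * Q.eval (-1)).valuation (Or.inr (Nat.ModEq.refl _))
    exact ⟨Q, d, rfl, hd2, hd1⟩
  by_cases h0 : F.eval 1 * F.eval (-1) = 0
  · obtain ⟨t, ht, hroot⟩ : ∃ t : ℤ_[2], t * t = 1 ∧ F.eval t = 0 := by
      rcases mul_eq_zero.1 h0 with h | h
      · exact ⟨1, by ring, h⟩
      · exact ⟨-1, by ring, h⟩
    obtain ⟨Q, d, rfl, hQ, -⟩ := hquot (X - C t) (monic_X_sub_C t) (IsSymmPoly.X_sub_C ht)
      (by rw [natDegree_X_sub_C]; exact one_ne_zero) (dvd_iff_isRoot.2 hroot)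
    by_cases hde : d ≡ e [MOD 2]
    · have h1 := (hasInvolutivePair_X_sub_C ht one_ne_zero).mul hQ
      rw [valuation_eq_zero_of_isUnit isUnit_one, zero_add] at h1
      exact ⟨d, hde, h1⟩
    · have h1 := (hasInvolutivePair_X_sub_C ht two_ne_zero).mul hQ
      rw [valuation_two] at h1
      refine ⟨1 + d, ?_, h1⟩
      rw [Nat.ModEq] at hde ⊢
      omega
  · obtain ⟨A, a, hA, hAs, hAF, hAd, hAp, ha⟩ := exists_symmetric_factor hF hs hd h0
    obtain ⟨Q, d, hQ, hQp, hQd⟩ := hquot A hA hAs hAd hAF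
    subst hQ
    have hmul : (A * Q).eval 1 * (A * Q).eval (-1) =
        (A.eval 1 * A.eval (-1)) * (Q.eval 1 * Q.eval (-1)) := by
      rw [eval_mul, eval_mul]
      ring
    have hval := he.resolve_left h0
    rw [hmul] at h0 hval
    rw [PadicInt.valuation_mul (left_ne_zero_of_mul h0) (right_ne_zero_of_mul h0)] at hval
    exact ⟨a + d, (ha.add hQd).trans hval, hAp.mul hQp⟩

end Induction

theorem unimodular_padic_lattice_isometry_iff_two
    (F : Polynomial ℤ_[2]) (hmonic : F.Monic) (hsymm : IsSymmPoly F) :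
    HasSemisimpleIsometryUnimodularPadic 2 F ↔
      (F.eval 1 * F.eval (-1) = 0 ∨ Even (F.eval 1 * F.eval (-1)).valuation) := by
  constructor
  · rintro ⟨G, T, hG, hdet, -, hT, -, hc⟩
    rw [or_iff_not_imp_left]
    intro h0
    have hF : T.charpoly = F := by
      rw [charpoly_map] at hc
      exact Polynomial.map_injective (PadicInt.Coe.ringHom : ℤ_[2] →+* ℚ_[2])
        Subtype.coe_injective hc
    rw [← hF] at h0 ⊢
    exact even_valuation_of_isom hG hdet hT h0
  · intro h
    obtain ⟨d, hd, hp⟩ := exists_hasInvolutivePair _ F rfl hmonic hsymm 0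
      (h.imp_right fun h1 => Nat.even_iff.1 h1)
    exact hp.hasSemisimpleIsometry (Nat.even_iff.2 hd)
end

section
/- Let F ∈ ℤ₂[X] be a monic symmetric polynomial of even degree 2n with F(0) = 1, and assume there exists an even unimodular ℤ₂-lattice having a semisimple isometry with characteristic polynomial F. Then: (a) (F(1) = 0 or the 2-adic valuation of F(1) is even) and (F(−1) = 0 or the 2-adic valuation of F(−1) is even); and (b) if F(1)·F(−1) ≠ 0 then there exists c ∈ ℚ₂^× such that (−1)^n·F(1)·F(−1) = c² or (−1)^n·F(1)·F(−1) = −3·c². -/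
open Polynomial Matrix

/-- There exists an *even* unimodular `ℤ_p`-lattice having a semisimple isometry
with characteristic polynomial `F`. -/
def HasSemisimpleIsometryEvenUnimodularPadic (p : ℕ) [Fact p.Prime]
    (F : Polynomial ℤ_[p]) : Prop :=
  ∃ G T : Matrix (Fin F.natDegree) (Fin F.natDegree) ℤ_[p],
    G.IsSymm ∧ (∀ i, (2 : ℤ_[p]) ∣ G i i) ∧ IsUnit G.det ∧ IsUnit T.det ∧
    Tᵀ * G * T = G ∧
    Module.End.IsSemisimple (Matrix.toLin' (T.map (PadicInt.Coe.ringHom : ℤ_[p] →+* ℚ_[p]))) ∧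
    (T.map (PadicInt.Coe.ringHom : ℤ_[p] →+* ℚ_[p])).charpoly =
      F.map (PadicInt.Coe.ringHom : ℤ_[p] →+* ℚ_[p])

namespace Matrix

/-- The bilinear form attached to `M` is alternating. -/
def IsAlternating {ι R : Type*} [Fintype ι] [CommRing R] (M : Matrix ι ι R) : Prop :=
  ∀ x : ι → R, x ⬝ᵥ M *ᵥ x = 0

section Alternating

variable {ι κ R : Type*} [Fintype ι] [Fintype κ] [CommRing R] {M : Matrix ι ι R}

theorem IsAlternating.congruence (hM : M.IsAlternating) (W : Matrix ι κ R) :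
    (Wᵀ * M * W).IsAlternating := fun x ↦ by
  have := hM (W *ᵥ x)
  rwa [dotProduct_mulVec, vecMul_mulVec, ← dotProduct_mulVec, mulVec_mulVec] at this

theorem IsAlternating.diag_eq_zero [DecidableEq ι] (hM : M.IsAlternating) (i : ι) :
    M i i = 0 := by
  simpa using hM (Pi.single i 1)

theorem IsAlternating.add_swap_eq_zero [DecidableEq ι] (hM : M.IsAlternating) (i j : ι) :
    M i j + M j i = 0 := by
  have := hM (Pi.single i 1 + Pi.single j 1)
  simpa [mulVec_add, hM.diag_eq_zero, add_comm] using this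

theorem IsAlternating.map {S : Type*} [CommRing S] [DecidableEq ι] (hM : M.IsAlternating)
    [IsDomain S] (h2 : (2 : S) ≠ 0) (f : R →+* S) : (M.map f).IsAlternating := fun x ↦ by
  have h : (M.map f)ᵀ = -M.map f := by
    ext i j
    have := congrArg f (hM.add_swap_eq_zero i j)
    simp only [map_add, map_zero] at this
    simpa using eq_neg_of_add_eq_zero_right this
  have h' : x ⬝ᵥ M.map f *ᵥ x = -(x ⬝ᵥ M.map f *ᵥ x) := by
    conv_lhs => rw [dotProduct_mulVec, ← mulVec_transpose, h, neg_mulVec, neg_dotProduct,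
      dotProduct_comm]
  have : 2 * (x ⬝ᵥ M.map f *ᵥ x) = 0 := by linear_combination h'
  exact (mul_eq_zero.mp this).resolve_left h2

end Alternating

section Schur

variable {ι R : Type*} [Fintype ι] [DecidableEq ι] [CommRing R]

theorem exists_schur_complement_fromBlocks {m n : Type*} [Fintype m] [Fintype n] [DecidableEq m]
    [DecidableEq n] (B : Matrix (m ⊕ n) (m ⊕ n) R) (h : IsUnit B.toBlocks₁₁.det) :
    ∃ (W : Matrix (m ⊕ n) n R) (S : Matrix n n R),
      B * W = fromRows (0 : Matrix m n R) (1 : Matrix n n R) * S ∧ Wᵀ * fromRows (0 : Matrix m n R) (1 : Matrix n n R) = 1 ∧ B.det = B.toBlocks₁₁.det * S.det := by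
  have := invertibleOfIsUnitDet _ h
  refine ⟨fromRows (-(⅟B.toBlocks₁₁ * B.toBlocks₁₂)) 1,
    B.toBlocks₂₂ - B.toBlocks₂₁ * ⅟B.toBlocks₁₁ * B.toBlocks₁₂, ?_, ?_, ?_⟩
  · conv_lhs => enter [1]; rw [← fromBlocks_toBlocks B]
    rw [fromBlocks_mul_fromRows, fromRows_mul]
    congr 1
    · simp
    · simp [Matrix.mul_assoc, sub_eq_neg_add]
  · rw [transpose_fromRows, fromCols_mul_fromRows]
    simp
  · conv_lhs => rw [← fromBlocks_toBlocks B, det_fromBlocks₁₁]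

/-- Splitting off a nondegenerate principal block: `S` is the Schur complement. -/
theorem exists_schur_complement (B : Matrix ι ι R) (p : ι → Prop) [DecidablePred p]
    (h : IsUnit (B.submatrix ((↑) : {i // p i} → ι) (↑)).det) :
    ∃ (W : Matrix ι {i // ¬ p i} R) (S : Matrix {i // ¬ p i} {i // ¬ p i} R),
      Wᵀ * B * W = S ∧ (∀ A : Matrix ι ι R,
        Wᵀ * (Bᵀ * A * B) * W = Sᵀ * A.submatrix (↑) (↑) * S) ∧
      B.det = (B.submatrix ((↑) : {i // p i} → ι) (↑)).det * S.det := by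
  let e := Equiv.sumCompl p
  obtain ⟨W, S, h1, h2, h3⟩ := exists_schur_complement_fromBlocks (B.submatrix e e) h
  let E : Matrix ι {i // ¬ p i} R := (1 : Matrix ι ι R).submatrix id (↑)
  have hE : (fromRows 0 1 : Matrix ({i // p i} ⊕ {i // ¬ p i}) {i // ¬ p i} R)
      = E.submatrix e id := by
    ext i j
    rcases i with i | i
    · have : (i : ι) ≠ j := fun hij ↦ j.2 (hij ▸ i.2)
      simp [E, e, this]
    · simp [E, e, one_apply, Subtype.ext_iff]
  have h1' : B * W.submatrix e.symm id = E * S := by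
    have h4 : (B.submatrix e e * W).submatrix e.symm id = B * W.submatrix e.symm id := by
      rw [← submatrix_mul_equiv _ _ _ e.symm]
      simp
    rw [← h4, h1, hE]
    ext i j
    simp [mul_apply]
  have h2' : (W.submatrix e.symm id)ᵀ * E = 1 := by
    rw [hE, ← submatrix_id_id Wᵀ] at h2
    have := congrArg (fun N ↦ N.submatrix id id) h2
    rw [← submatrix_mul_equiv _ _ _ e.symm] at this
    simpa using this
  refine ⟨W.submatrix e.symm id, S, ?_, fun A ↦ ?_, ?_⟩
  · rw [Matrix.mul_assoc, h1', ← Matrix.mul_assoc, h2', Matrix.one_mul]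
  · have hA : Eᵀ * A * E = A.submatrix (↑) (↑) := by
      ext i j
      simp [E, mul_apply, one_apply]
    rw [← hA]
    calc _ = (B * W.submatrix e.symm id)ᵀ * A * (B * W.submatrix e.symm id) := by
          simp only [transpose_mul, Matrix.mul_assoc]
      _ = _ := by rw [h1']; simp only [transpose_mul, Matrix.mul_assoc]
  · rw [← det_submatrix_equiv_self e B, h3]
    rfl

theorem det_submatrix_of_forall_eq {p : ι → Prop} [DecidablePred p] {a : ι} (ha : p a)
    (hp : ∀ i, p i → i = a) (M : Matrix ι ι R) :
    (M.submatrix ((↑) : {i // p i} → ι) (↑)).det = M a a := by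
  have : Subsingleton {i // p i} := ⟨fun i j ↦ Subtype.ext ((hp i i.2).trans (hp j j.2).symm)⟩
  exact det_eq_elem_of_subsingleton _ (⟨a, ha⟩ : {i // p i})

theorem det_submatrix_eq_or {a b : ι} (hab : a ≠ b) (M : Matrix ι ι R) :
    (M.submatrix ((↑) : {i // i = a ∨ i = b} → ι) (↑)).det
      = M a a * M b b - M a b * M b a := by
  let f : Fin 2 → {i // i = a ∨ i = b} := ![⟨a, .inl rfl⟩, ⟨b, .inr rfl⟩]
  have hf : Function.Bijective f := by
    constructor
    · intro i j
      fin_cases i <;> fin_cases j <;> simp [f, hab, hab.symm]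
    · rintro ⟨i, rfl | rfl⟩
      exacts [⟨0, rfl⟩, ⟨1, rfl⟩]
  rw [← det_submatrix_equiv_self (Equiv.ofBijective f hf), det_fin_two]
  rfl

end Schur

theorem IsAlternating.isSquare_det_of_field {K : Type*} [Field K] (k : ℕ) :
    ∀ (ι : Type) [Fintype ι] [DecidableEq ι] (M : Matrix ι ι K), Fintype.card ι = k →
      M.IsAlternating → IsSquare M.det := by
  induction k using Nat.strong_induction_on with
  | _ k ih =>
  intro ι _ _ M hk hM
  by_cases h0 : M = 0
  · subst h0
    cases isEmpty_or_nonempty ι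
    · simp
    · simp [det_zero]
  obtain ⟨a, b, hab⟩ : ∃ a b, M a b ≠ 0 := by
    by_contra! h
    exact h0 (ext h)
  have hne : a ≠ b := by
    rintro rfl
    exact hab (hM.diag_eq_zero a)
  have hdet : (M.submatrix ((↑) : {i // i = a ∨ i = b} → ι) (↑)).det = M a b * M a b := by
    rw [det_submatrix_eq_or hne, hM.diag_eq_zero, eq_neg_of_add_eq_zero_right
      (hM.add_swap_eq_zero a b)]
    ring
  obtain ⟨W, S, rfl, -, h3⟩ := exists_schur_complement M (fun i ↦ i = a ∨ i = b)
    (hdet ▸ (mul_ne_zero hab hab).isUnit)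
  rw [h3, hdet]
  exact (IsSquare.mul_self _).mul (ih _ (hk ▸ Fintype.card_subtype_lt (x := a) (by simp)) _ _ rfl
    (hM.congruence W))

theorem IsAlternating.isSquare_det {ι : Type} {R : Type*} [Fintype ι] [DecidableEq ι] [CommRing R]
    [IsDomain R] [IsIntegrallyClosed R] (h2 : (2 : R) ≠ 0) {M : Matrix ι ι R}
    (hM : M.IsAlternating) : IsSquare M.det := by
  have hinj := FaithfulSMul.algebraMap_injective R (FractionRing R)
  obtain ⟨s, hs⟩ := IsAlternating.isSquare_det_of_field _ ι _ rfl
    (hM.map (S := FractionRing R) (by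
      simpa only [map_ofNat, map_zero] using hinj.ne h2) (algebraMap R _))
  rw [← RingHom.mapMatrix_apply, ← RingHom.map_det] at hs
  obtain ⟨r, rfl⟩ := IsIntegrallyClosed.exists_algebraMap_eq_of_isIntegral_pow (R := R)
    (n := 2) (x := s) two_pos (by rw [sq, ← hs]; exact isIntegral_algebraMap)
  exact ⟨r, hinj (by simpa using hs)⟩

/-- If `B⁻¹ - A` is alternating and `A`, `B` are integral, then `det B` is a unit times a square.
The hypothesis is stated without inverting `B`. -/
theorem exists_det_eq_unit_mul_sq {R : Type*} [CommRing R] [IsDomain R] [IsIntegrallyClosed R]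
    [IsLocalRing R] (h2 : (2 : R) ≠ 0) (k : ℕ) :
    ∀ (ι : Type) [Fintype ι] [DecidableEq ι] (A B : Matrix ι ι R), Fintype.card ι = k →
      (B - Bᵀ * A * B).IsAlternating → ∃ (u : Rˣ) (s : R), B.det = u * s ^ 2 := by
  induction k using Nat.strong_induction_on with
  | _ k ih =>
  intro ι _ _ A B hk hAB
  have split (A B : Matrix ι ι R) (hAB : (B - Bᵀ * A * B).IsAlternating)
      (p : ι → Prop) [DecidablePred p] (a : ι) (ha : p a)
      (h : IsUnit (B.submatrix ((↑) : {i // p i} → ι) (↑)).det) :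
      ∃ (u : Rˣ) (s : R), B.det = u * s ^ 2 := by
    obtain ⟨W, S, h1, hA, h3⟩ := exists_schur_complement B p h
    obtain ⟨u, s, hs⟩ := ih _ (hk ▸ Fintype.card_subtype_lt (x := a) (by simpa using ha)) _
      (A.submatrix (↑) (↑)) S rfl (by
        rw [← hA, ← h1, ← Matrix.sub_mul, ← Matrix.mul_sub]
        exact hAB.congruence W)
    exact ⟨h.unit * u, s, by rw [h3, hs]; simp [mul_assoc]⟩
  have diag (A B : Matrix ι ι R) (hAB : (B - Bᵀ * A * B).IsAlternating) (a : ι)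
      (h : IsUnit (B a a)) : ∃ (u : Rˣ) (s : R), B.det = u * s ^ 2 :=
    split A B hAB (· = a) a rfl 
      ((congrArg IsUnit (det_submatrix_of_forall_eq (p := (· = a)) rfl (fun _ ↦ id) B)).mpr h)
  by_cases hd : ∃ a, IsUnit (B a a)
  · exact hd.elim (diag A B hAB)
  by_cases hz : ∃ a b, IsUnit (B a b)
  · obtain ⟨a, b, hab⟩ := hz
    push Not at hd
    have hne : a ≠ b := by
      rintro rfl
      exact hd a hab
    by_cases hba : IsUnit (B b a)
    · refine split A B hAB (fun i ↦ i = a ∨ i = b) a (.inl rfl) ?_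
      rw [det_submatrix_eq_or hne]
      have := hd a
      rw [← IsLocalRing.residue_ne_zero_iff_isUnit, not_ne_iff] at this
      rw [← IsLocalRing.residue_ne_zero_iff_isUnit] at hab hba ⊢
      simpa [this] using And.intro hab hba
    · let P := transvection b a (1 : R)
      have hP : P.det = 1 := det_transvection_of_ne _ _ hne.symm _
      have hPu : IsUnit P.det := by simp [hP]
      obtain ⟨u, s, hs⟩ := diag (P⁻¹ * A * (P⁻¹)ᵀ) (Pᵀ * B * P) (by
        have : Pᵀ * B * P - (Pᵀ * B * P)ᵀ * (P⁻¹ * A * (P⁻¹)ᵀ) * (Pᵀ * B * P)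
            = Pᵀ * (B - Bᵀ * A * B) * P := by
          have h1 : P * P⁻¹ = 1 := mul_nonsing_inv P hPu
          have h2 : (P⁻¹)ᵀ * Pᵀ = 1 := by rw [← transpose_mul, h1, transpose_one]
          calc _ = Pᵀ * B * P - Pᵀ * Bᵀ * (P * P⁻¹) * A * ((P⁻¹)ᵀ * Pᵀ) * B * P := by
                simp only [transpose_mul, transpose_transpose, Matrix.mul_assoc]
            _ = _ := by
                rw [h1, h2]
                simp only [Matrix.mul_one, Matrix.mul_sub, Matrix.sub_mul, Matrix.mul_assoc]
        rw [this]
        exact hAB.congruence P) a (by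
        have : (Pᵀ * B * P) a a = B a b + (B a a + B b a + B b b) := by
          simp [P, transvection, Matrix.add_mul, Matrix.mul_add]
          ring
        rw [this]
        have ha := hd a
        have hb := hd b
        rw [← IsLocalRing.residue_ne_zero_iff_isUnit, not_ne_iff] at hba ha hb
        rw [← IsLocalRing.residue_ne_zero_iff_isUnit] at hab ⊢
        simpa [ha, hb, hba] using hab)
      exact ⟨u, s, by simpa [hP] using hs⟩
  · push Not at hz
    obtain ⟨s, hs⟩ := hAB.isSquare_det h2
    have hB : B.map (IsLocalRing.residue R) = 0 := by
      ext i j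
      simpa using hz i j
    have hu : IsUnit (1 - Bᵀ * A).det := by
      rw [← isUnit_map_iff (IsLocalRing.residue R), RingHom.map_det, RingHom.mapMatrix_apply,
        Matrix.map_sub _ (map_sub _), Matrix.map_mul, transpose_map, hB]
      simp
    have : B - Bᵀ * A * B = (1 - Bᵀ * A) * B := by rw [Matrix.sub_mul, Matrix.one_mul]
    rw [this, det_mul] at hs
    refine ⟨hu.unit⁻¹, s, ?_⟩
    rw [sq, ← hs, ← mul_assoc]
    simp

end Matrix

namespace Matrix

variable {ι R : Type*} [Fintype ι] [CommRing R]

theorem isAlternating_sub_transpose (A : Matrix ι ι R) : (A - Aᵀ).IsAlternating := fun x ↦ by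
  rw [sub_mulVec, dotProduct_sub, mulVec_transpose, dotProduct_comm x (x ᵥ* A),
    ← dotProduct_mulVec, sub_self]

/-- A symmetric matrix with even diagonal is the polarization of an integral form. -/
theorem IsSymm.exists_add_transpose_eq {n : ℕ} {G : Matrix (Fin n) (Fin n) R} (hG : G.IsSymm)
    (hd : ∀ i, (2 : R) ∣ G i i) : ∃ A, A + Aᵀ = G := by
  choose d hd using hd
  refine ⟨of fun i j ↦ if i < j then G i j else if i = j then d i else 0, ?_⟩
  ext i j
  rcases lt_trichotomy i j with h | rfl | h
  · simp [h, h.not_gt, h.ne']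
  · simp [hd, two_mul]
  · simp [h, h.not_gt, h.ne', hG.apply]

/-- For an isometry `T` of an even unimodular lattice, the matrix `(1 - T) G⁻¹` satisfies the
hypothesis of `Matrix.exists_det_eq_unit_mul_sq`. -/
theorem isAlternating_of_isometry [DecidableEq ι] [IsDomain R] (h2 : (2 : R) ≠ 0)
    {A G T : Matrix ι ι R} (hA : A + Aᵀ = G) (hG : IsUnit G.det) (hT : Tᵀ * G * T = G) :
    ((1 - T) * G⁻¹ - ((1 - T) * G⁻¹)ᵀ * A * ((1 - T) * G⁻¹)).IsAlternating := by
  have key : (G * (1 - T) - (1 - T)ᵀ * A * (1 - T)).IsAlternating := fun x ↦ by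
    have h : (G * (1 - T) - (1 - T)ᵀ * A * (1 - T)) + (G * (1 - T) - (1 - T)ᵀ * A * (1 - T))ᵀ
        = 0 := by
      have hGs : Gᵀ = G := by rw [← hA, transpose_add, transpose_transpose, add_comm]
      have hS : (1 - T)ᵀ * A * (1 - T) + ((1 - T)ᵀ * A * (1 - T))ᵀ = (1 - T)ᵀ * G * (1 - T) := by
        rw [← hA]
        simp only [transpose_mul, transpose_transpose, Matrix.mul_add, Matrix.add_mul,
          Matrix.mul_assoc]
      have hS' : (1 - T)ᵀ * G * (1 - T) = G * (1 - T) + (G * (1 - T))ᵀ := by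
        have : (1 - T)ᵀ * G * (1 - T) = G - G * T - Tᵀ * G + Tᵀ * G * T := by
          simp only [transpose_sub, transpose_one]
          noncomm_ring
        rw [this, hT, transpose_mul, hGs, transpose_sub, transpose_one]
        noncomm_ring
      rw [transpose_sub (G * (1 - T)), sub_add_sub_comm, hS, hS', sub_self]
    set M := G * (1 - T) - (1 - T)ᵀ * A * (1 - T)
    have h1 : x ⬝ᵥ (M + Mᵀ) *ᵥ x = 2 * (x ⬝ᵥ M *ᵥ x) := by
      rw [add_mulVec, dotProduct_add, mulVec_transpose, dotProduct_comm x (x ᵥ* M),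
        ← dotProduct_mulVec, two_mul]
    rw [h, zero_mulVec, dotProduct_zero] at h1
    exact (mul_eq_zero.mp h1.symm).resolve_left h2
  have hGs : (G⁻¹)ᵀ = G⁻¹ := by
    rw [transpose_nonsing_inv, ← hA, transpose_add, transpose_transpose, add_comm]
  convert key.congruence G⁻¹ using 1
  rw [hGs, transpose_mul, hGs, Matrix.mul_sub, Matrix.sub_mul, ← Matrix.mul_assoc G⁻¹ G,
    nonsing_inv_mul _ hG, Matrix.one_mul]
  simp only [Matrix.mul_assoc, Matrix.sub_mul, Matrix.one_mul, Matrix.mul_sub]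

/-- The discriminant of an even unimodular lattice over a local ring with `2` not invertible. -/
theorem exists_det_eq_of_add_transpose [IsDomain R] [IsIntegrallyClosed R]
    [IsLocalRing R] (h2 : (2 : R) ≠ 0) (h2' : ¬ IsUnit (2 : R)) {n : ℕ} {ι : Type} [Fintype ι]
    [DecidableEq ι] (hι : Fintype.card ι = 2 * n)
    {A G : Matrix ι ι R} (hA : A + Aᵀ = G) (hG : IsUnit G.det) :
    ∃ t z : R, IsUnit t ∧ (-1) ^ n * G.det = t ^ 2 * (1 + 4 * z) := by
  set K := A - Aᵀ with hK
  have hKalt : K.IsAlternating := isAlternating_sub_transpose A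
  have hGK : G = K + (2 : R) • Aᵀ := by
    rw [hK, ← hA, two_smul]
    abel
  have hKu : IsUnit K.det := by
    have h2r : IsLocalRing.residue R 2 = 0 := by
      simpa using h2'
    have : G.map (IsLocalRing.residue R) = K.map (IsLocalRing.residue R) := by
      ext i j
      simp [hGK, h2r]
    rw [← isUnit_map_iff (IsLocalRing.residue R), RingHom.map_det, RingHom.mapMatrix_apply,
      ← this, ← RingHom.mapMatrix_apply, ← RingHom.map_det]
    exact hG.map _
  obtain ⟨t, ht⟩ := hKalt.isSquare_det h2
  have hKt : Kᵀ = -K := by rw [hK, transpose_sub, transpose_transpose, neg_sub]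
  have hKit : (K⁻¹)ᵀ = -K⁻¹ := by
    rw [transpose_nonsing_inv, hKt]
    exact inv_eq_right_inv (by rw [neg_mul_neg, mul_nonsing_inv _ hKu])
  have htr : trace (K⁻¹ * Aᵀ) = -n := by
    have h1 : trace (K⁻¹ * Aᵀ) = -trace (K⁻¹ * A) := by
      rw [← trace_transpose, transpose_mul, transpose_transpose, hKit, Matrix.mul_neg, trace_neg,
        trace_mul_comm]
    have h3 : trace (K⁻¹ * A) - trace (K⁻¹ * Aᵀ) = 2 * n := by
      rw [← trace_sub, ← Matrix.mul_sub, ← hK, nonsing_inv_mul _ hKu, trace_one, hι]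
      push_cast
      rfl
    refine mul_left_cancel₀ h2 ?_
    linear_combination h1 - h3
  have hdet : G.det = K.det * det (1 + (2 : R) • (K⁻¹ * Aᵀ)) := by
    rw [← det_mul, hGK, Matrix.mul_add, Matrix.mul_one, Matrix.mul_smul, ← Matrix.mul_assoc,
      mul_nonsing_inv _ hKu, Matrix.one_mul]
  rw [det_one_add_smul, htr, ht] at hdet
  have hsign : ∃ m : R, (-1) ^ n * (1 - 2 * n : R) = 1 + 4 * m := by
    rcases Nat.even_or_odd' n with ⟨k, rfl | rfl⟩
    · exact ⟨-k, by simp; ring⟩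
    · exact ⟨k, by simp [pow_succ]; ring⟩
  obtain ⟨m, hm⟩ := hsign
  rw [ht] at hKu
  refine ⟨t, m + (-1) ^ n * Polynomial.eval 2 (divX (divX (det (1 + (X : R[X]) • (K⁻¹ * Aᵀ).map C)))),
    isUnit_of_mul_isUnit_left hKu, ?_⟩
  rw [hdet]
  linear_combination t ^ 2 * hm

/-- The determinant of `1 - T²` for an isometry `T` is the discriminant up to squares. -/
theorem isSquare_det_mul_det_one_sub_mul_det_one_add {ι : Type} [Fintype ι]
    [DecidableEq ι] [IsDomain R] [IsIntegrallyClosed R] (h2 : (2 : R) ≠ 0)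
    (hι : Even (Fintype.card ι)) {G T : Matrix ι ι R} (hG : G.IsSymm) (hT : Tᵀ * G * T = G)
    (hdet : T.det = 1) : IsSquare (G.det * ((1 - T).det * (1 + T).det)) := by
  have h := (isAlternating_sub_transpose (G * T)).isSquare_det h2
  have h' : (G * T - (G * T)ᵀ) * T = -(G * ((1 - T) * (1 + T))) := by
    rw [transpose_mul, hG.eq, Matrix.sub_mul, hT]
    noncomm_ring
  have := congrArg det h'
  rw [det_mul, hdet, mul_one, det_neg, hι.neg_one_pow, one_mul, det_mul, det_mul] at this
  rwa [this] at h

end Matrix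

namespace PadicInt

theorem isSquare_of_eight_dvd_sub_one {a : ℤ_[2]} (ha : 8 ∣ a - 1) : IsSquare a := by
  obtain ⟨b, hb⟩ := ha
  have hn : ‖(X ^ 2 - C a : ℤ_[2][X]).aeval (1 : ℤ_[2])‖
      < ‖(derivative (X ^ 2 - C a : ℤ_[2][X])).aeval (1 : ℤ_[2])‖ ^ 2 := by
    have h1 : (X ^ 2 - C a : ℤ_[2][X]).aeval (1 : ℤ_[2]) = 2 ^ 3 * -b := by
      simp
      linear_combination -hb
    have h2 : (derivative (X ^ 2 - C a : ℤ_[2][X])).aeval (1 : ℤ_[2]) = 2 := by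
      simp [one_add_one_eq_two]
    have h3 : ‖(2 : ℤ_[2])‖ = 2⁻¹ := by simpa using norm_p (p := 2)
    rw [h1, h2, norm_mul, norm_pow, h3]
    nlinarith [norm_le_one (-b), norm_nonneg (-b)]
  obtain ⟨z, hz, -⟩ := hensels_lemma hn
  refine ⟨z, ?_⟩
  simp at hz
  linear_combination -hz

theorem isUnit_of_two_dvd_sub_one {a : ℤ_[2]} (ha : 2 ∣ a - 1) : IsUnit a := by
  by_contra h
  have h2 : (2 : ℤ_[2]) ∣ a := by
    rw [← mem_nonunits_iff, mem_nonunits] at h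
    simpa using (norm_lt_one_iff_dvd a).mp h
  have : (2 : ℤ_[2]) ∣ 1 := by simpa using dvd_sub h2 ha
  exact (prime_p (p := 2)).not_isUnit (isUnit_of_dvd_one (by simpa using this))

/-- The units congruent to `1` modulo `4` have square class `1` or `-3`. -/
theorem exists_sq_or_of_one_add_four_mul (z : ℤ_[2]) :
    ∃ c : ℤ_[2], IsUnit c ∧ (1 + 4 * z = c ^ 2 ∨ 1 + 4 * z = -3 * c ^ 2) := by
  have hu : IsUnit (1 + 4 * z) := isUnit_of_two_dvd_sub_one ⟨2 * z, by ring⟩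
  have key : ∃ y, z = 2 * y ∨ z = 2 * y + 1 := by
    by_cases hz : IsUnit z
    · have h1 : z.toZMod = 1 := by
        have : z.toZMod ≠ 0 := (hz.map toZMod).ne_zero
        generalize z.toZMod = w at *
        revert w
        decide
      have h2 : z - 1 ∈ RingHom.ker (toZMod (p := 2)) := by simp [RingHom.mem_ker, h1]
      rw [ker_toZMod, maximalIdeal_eq_span_p, Ideal.mem_span_singleton] at h2
      obtain ⟨y, hy⟩ := h2
      refine ⟨y, .inr ?_⟩
      push_cast at hy
      linear_combination hy
    · rw [← mem_nonunits_iff, mem_nonunits, norm_lt_one_iff_dvd] at hz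
      obtain ⟨y, hy⟩ := hz
      exact ⟨y, .inl (by simpa using hy)⟩
  obtain ⟨y, rfl | rfl⟩ := key
  · obtain ⟨c, hc⟩ := isSquare_of_eight_dvd_sub_one (a := 1 + 4 * (2 * y)) ⟨y, by ring⟩
    rw [hc] at hu
    exact ⟨c, isUnit_of_mul_isUnit_left hu, .inl (by rw [hc, sq])⟩
  · have h3 : IsUnit (-3 : ℤ_[2]) := isUnit_of_two_dvd_sub_one ⟨-2, by ring⟩
    obtain ⟨v, hv⟩ := h3.exists_right_inv
    obtain ⟨c, hc⟩ := isSquare_of_eight_dvd_sub_one (a := v * (1 + 4 * (2 * y + 1)))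
      ⟨v * (y + 1), by linear_combination hv⟩
    have hu' : IsUnit (c * c) := hc ▸ (IsUnit.of_mul_eq_one _ (by rwa [mul_comm] at hv)).mul hu
    refine ⟨c, isUnit_of_mul_isUnit_left hu', .inr ?_⟩
    rw [sq, ← hc]
    linear_combination -(1 + 4 * (2 * y + 1)) * hv

theorem even_valuation_of_eq_unit_mul_sq {p : ℕ} [Fact p.Prime] {a s : ℤ_[p]} (u : ℤ_[p]ˣ)
    (h : a = u * s ^ 2) : a = 0 ∨ Even a.valuation := by
  by_cases hs : s = 0
  · left
    simp [h, hs]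
  · right
    have hu : (u : ℤ_[p]).valuation = 0 := by
      have := congrArg valuation u.mul_inv
      rw [valuation_mul u.ne_zero u⁻¹.ne_zero, valuation_one] at this
      omega
    rw [h, valuation_mul u.ne_zero (pow_ne_zero _ hs), hu, valuation_pow]
    simp

end PadicInt

/-- For an isometry `T` of an even unimodular `ℤ₂`-lattice, `det (1 - T)` is zero or has even
valuation. -/
theorem even_valuation_det_one_sub_of_isometry {ι : Type} [Fintype ι] [DecidableEq ι]
    {A G T : Matrix ι ι ℤ_[2]} (hA : A + Aᵀ = G) (hG : IsUnit G.det) (hT : Tᵀ * G * T = G) :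
    (1 - T).det = 0 ∨ Even (1 - T).det.valuation := by
  obtain ⟨u, s, hus⟩ := exists_det_eq_unit_mul_sq two_ne_zero _ ι A _ rfl
    (isAlternating_of_isometry two_ne_zero hA hG hT)
  refine PadicInt.even_valuation_of_eq_unit_mul_sq (hG.unit * u) (s := s) ?_
  rw [Units.val_mul, mul_assoc, ← hus, det_mul, IsUnit.unit_spec, mul_comm, mul_assoc, ← det_mul,
    nonsing_inv_mul _ hG, det_one, mul_one]

theorem even_unimodular_two_adic_lattice_isometry_necessary
    (F : Polynomial ℤ_[2]) (n : ℕ) (hmonic : F.Monic)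
    (hsymm : IsSymmPoly F) (hdeg : F.natDegree = 2 * n) (h0 : F.coeff 0 = 1)
    (h : HasSemisimpleIsometryEvenUnimodularPadic 2 F) :
    ((F.eval 1 = 0 ∨ Even (F.eval 1).valuation) ∧
      (F.eval (-1) = 0 ∨ Even (F.eval (-1)).valuation)) ∧
    (F.eval 1 * F.eval (-1) ≠ 0 →
      ∃ c : ℚ_[2], c ≠ 0 ∧
        ((-1 : ℚ_[2]) ^ n * ((F.eval 1 : ℤ_[2]) : ℚ_[2]) * ((F.eval (-1) : ℤ_[2]) : ℚ_[2]) = c ^ 2 ∨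
         (-1 : ℚ_[2]) ^ n * ((F.eval 1 : ℤ_[2]) : ℚ_[2]) * ((F.eval (-1) : ℤ_[2]) : ℚ_[2]) = -3 * c ^ 2)) := by
  obtain ⟨G, T, hGs, hGd, hG, -, hT, -, hchar⟩ := h
  have hcard : Fintype.card (Fin F.natDegree) = 2 * n := by simpa using hdeg
  have hF : T.charpoly = F := by
    rw [charpoly_map] at hchar
    exact map_injective _ Subtype.val_injective hchar
  have hF1 : F.eval 1 = (1 - T).det := by
    conv_lhs => rw [← hF]
    rw [eval_charpoly]
    simp
  have hF2 : F.eval (-1) = (1 + T).det := by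
    conv_lhs => rw [← hF]
    rw [eval_charpoly, map_neg, ← neg_add', det_neg, hcard, pow_mul]
    simp
  have hdet : T.det = 1 := by
    rw [det_eq_sign_charpoly_coeff, hF, h0, hcard, pow_mul]
    simp
  obtain ⟨A, hA⟩ := hGs.exists_add_transpose_eq hGd
  refine ⟨⟨?_, ?_⟩, fun hne ↦ ?_⟩
  · rw [hF1]
    exact even_valuation_det_one_sub_of_isometry hA hG hT
  · rw [hF2, ← sub_neg_eq_add]
    exact even_valuation_det_one_sub_of_isometry hA hG (by simpa using hT)
  · have h2 : ¬ IsUnit (2 : ℤ_[2]) := by simpa using (PadicInt.prime_p (p := 2)).not_isUnit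
    obtain ⟨t, z, ht, hz⟩ := exists_det_eq_of_add_transpose two_ne_zero h2 hcard hA hG
    obtain ⟨s, hs⟩ := isSquare_det_mul_det_one_sub_mul_det_one_add two_ne_zero
      (hcard ▸ even_two_mul n) hGs hT hdet
    obtain ⟨c, hc, hcz⟩ := PadicInt.exists_sq_or_of_one_add_four_mul z
    rw [← hF1, ← hF2] at hs
    set a := F.eval 1
    set b := F.eval (-1)
    obtain ⟨w, hw⟩ := hG.exists_right_inv
    have hs0 : s ≠ 0 := by
      rintro rfl
      exact mul_ne_zero hG.ne_zero hne (by simpa using hs)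
    have hw0 : w ≠ 0 := right_ne_zero_of_mul_eq_one hw
    have hab : (-1) ^ n * a * b = (t * s * w) ^ 2 * (1 + 4 * z) := by
      linear_combination (s * w) ^ 2 * hz - (-1) ^ n * a * b * (G.det * w + 1) * hw
        + (-1) ^ n * G.det * w ^ 2 * hs
    let f : ℤ_[2] →+* ℚ_[2] := PadicInt.Coe.ringHom
    have hf : Function.Injective f := Subtype.val_injective
    refine ⟨f t * f s * f w * f c, ?_, hcz.imp (fun hcz ↦ ?_) fun hcz ↦ ?_⟩
    · simpa [map_ne_zero_iff f hf, hs0, hw0] using And.intro ht.ne_zero hc.ne_zero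
    all_goals
      rw [hcz] at hab
      have := congrArg f hab
      simp only [map_mul, map_pow, map_neg, map_one, map_ofNat] at this
      exact this.trans (by ring)
end

section
/- Let p be an odd prime number and let m ≥ 2 be an integer such that p − 1 + m ≡ 0 (mod 8). Then there exists a positive definite even unimodular ℤ-lattice of rank p − 1 + m having a semisimple isometry with characteristic polynomial Φ_p(X)·(X−1)^m, where Φ_p is the p-th cyclotomic polynomial. -/
open Polynomial Matrix

/-- There exists an even unimodular `ℤ`-lattice of signature `(r,s)` having a
semisimple isometry with characteristic polynomial `F`: a symmetric integer
Gram matrix `G` with even diagonal, determinant `±1`, whose real version has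
exactly `r` positive and `s` negative eigenvalues (roots of its characteristic
polynomial, with multiplicity), together with a matrix `T` satisfying
`Tᵀ G T = G` which is semisimple over `ℚ` with characteristic polynomial `F`. -/
def HasSemisimpleIsometryEvenUnimodularZLattice (r s : ℕ) (F : Polynomial ℤ) : Prop :=
  ∃ G T : Matrix (Fin (r + s)) (Fin (r + s)) ℤ,
    G.IsSymm ∧ (∀ i, 2 ∣ G i i) ∧ (G.det = 1 ∨ G.det = -1) ∧
    Multiset.card (((G.map (Int.castRingHom ℝ)).charpoly.roots).filter fun x => 0 < x) = r ∧
    Multiset.card (((G.map (Int.castRingHom ℝ)).charpoly.roots).filter fun x => x < 0) = s ∧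
    IsUnit T.det ∧ Tᵀ * G * T = G ∧
    Module.End.IsSemisimple (Matrix.toLin' (T.map (Int.castRingHom ℚ))) ∧
    (T.map (Int.castRingHom ℚ)).charpoly = F.map (Int.castRingHom ℚ)

open Equiv

/-- A matrix whose columns form a basis of the lattice `D_n⁺`, where `n = N + 2`: the vectors
`2 e₀`, `e_j - e₀` for `0 < j < N + 1`, and `(1/2, …, 1/2)`. -/
def dPlusBasis (N : ℕ) : Matrix (Fin (N + 2)) (Fin (N + 2)) ℚ := fun i j =>
  if j = Fin.last (N + 1) then 1 / 2
  else if j = 0 then (if i = 0 then 2 else 0)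
  else (if i = j then 1 else 0) - (if i = 0 then 1 else 0)

theorem det_dPlusBasis (N : ℕ) : (dPlusBasis N).det = 1 := by
  rw [Matrix.det_of_isUpperTriangular]
  · have h : ∀ i, dPlusBasis N i i =
        (if i = 0 then 2 else 1) * (if i = Fin.last (N + 1) then 1 / 2 else 1) := by
      intro i
      by_cases h1 : i = Fin.last (N + 1)
      · have : i ≠ 0 := by rw [h1]; exact Fin.last_pos.ne'
        simp [dPlusBasis, h1]
      · by_cases h2 : i = 0
        · have : (0 : Fin (N + 2)) ≠ Fin.last (N + 1) := Fin.last_pos.ne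
          simp [dPlusBasis, h2, this]
        · simp [dPlusBasis, h1, h2]
    rw [Finset.prod_congr rfl fun i _ => h i, Finset.prod_mul_distrib]
    simp
  · intro i j hij
    have hij : j < i := hij
    have h1 : j ≠ Fin.last (N + 1) := (hij.trans_le (Fin.le_last i)).ne
    have h2 : i ≠ 0 := ((Fin.zero_le j).trans_lt hij).ne'
    simp [dPlusBasis, h1, h2, hij.ne']

/-- Integer vectors with even coordinate sum lie in `D_n⁺` when `n` is even. -/
theorem exists_dPlusBasis_mulVec_eq {N : ℕ} (hN : 2 ∣ N) (w : Fin (N + 2) → ℤ)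
    (hw : 2 ∣ ∑ i, w i) :
    ∃ x : Fin (N + 2) → ℤ, dPlusBasis N *ᵥ (fun i => (x i : ℚ)) = fun i => (w i : ℚ) := by
  obtain ⟨s, hs⟩ := hw
  obtain ⟨k, rfl⟩ := hN
  set z := Fin.last (2 * k + 1) with hz
  have hz0 : z ≠ 0 := Fin.last_pos.ne'
  refine ⟨fun j => if j = z then 2 * w z else if j = 0 then s - (k + 1) * w z
    else w j - w z, ?_⟩
  have hmid : ∀ j : Fin (2 * k), (j.castSucc.succ : Fin (2 * k + 2)) ≠ z ∧
      (j.castSucc.succ : Fin (2 * k + 2)) ≠ 0 := fun j =>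
    ⟨by rw [hz, ← Fin.succ_last]; simp, Fin.succ_ne_zero _⟩
  funext i
  rw [Fin.sum_univ_succ, Fin.sum_univ_castSucc, Fin.succ_last, ← hz] at hs
  simp only [Matrix.mulVec, dotProduct]
  rw [Fin.sum_univ_succ, Fin.sum_univ_castSucc, Fin.succ_last, ← hz]
  simp only [dPlusBasis, ← hz, hz0.symm, (hmid _).1, (hmid _).2, if_true, if_false]
  by_cases hi0 : i = 0
  · subst hi0
    have hs' : (w 0 : ℚ) + (∑ j : Fin (2 * k), (w j.castSucc.succ : ℚ) + w z) = 2 * s := by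
      exact_mod_cast hs
    simp only [(hmid _).2.symm, if_true, if_false]
    push_cast
    simp only [zero_sub, neg_mul, one_mul, neg_sub, Finset.sum_sub_distrib, Finset.sum_const,
      Finset.card_univ, Fintype.card_fin, nsmul_eq_mul]
    push_cast
    linarith
  · by_cases hiz : i = z
    · subst hiz
      simp [hz0, (hmid _).1.symm]
    · have h : ∃ j : Fin (2 * k), i = j.castSucc.succ := by
        obtain ⟨i', rfl⟩ := Fin.exists_succ_eq.2 hi0
        have : i' ≠ Fin.last _ := by
          rintro rfl
          exact hiz (by rw [hz, Fin.succ_last])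
        obtain ⟨j, rfl⟩ := Fin.exists_castSucc_eq.2 this
        exact ⟨j, rfl⟩
      obtain ⟨j, rfl⟩ := h
      simp [Fin.succ_inj, Fin.castSucc_inj]

theorem dPlusBasis_col_of_ne_last {N : ℕ} {j : Fin (N + 2)} (hj : j ≠ Fin.last (N + 1)) :
    ∃ w : Fin (N + 2) → ℤ, 2 ∣ ∑ i, w i ∧ ∀ i, dPlusBasis N i j = w i := by
  by_cases h0 : j = 0
  · refine ⟨fun i => if i = 0 then 2 else 0, by simp, fun i => ?_⟩
    subst h0
    simp [dPlusBasis, hj]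
  · refine ⟨fun i => (if i = j then 1 else 0) - (if i = 0 then 1 else 0), by simp, fun i => ?_⟩
    simp [dPlusBasis, hj, h0]

/-- The lattice `D_n⁺` is preserved by coordinate permutations when `n` is even. -/
theorem exists_dPlusBasis_mul_eq_permMatrix_mul {N : ℕ} (hN : 2 ∣ N) (σ : Perm (Fin (N + 2))) :
    ∃ T : Matrix (Fin (N + 2)) (Fin (N + 2)) ℤ,
      dPlusBasis N * T.map (Int.castRingHom ℚ) = σ.permMatrix ℚ * dPlusBasis N := by
  have key : ∀ j, ∃ x : Fin (N + 2) → ℤ, dPlusBasis N *ᵥ (fun i => (x i : ℚ)) =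
      fun i => dPlusBasis N (σ i) j := by
    intro j
    by_cases hj : j = Fin.last (N + 1)
    · refine ⟨Pi.single j 1, ?_⟩
      have : (fun i => ((Pi.single j (1 : ℤ) : Fin (N + 2) → ℤ) i : ℚ)) = Pi.single j 1 := by
        funext i
        by_cases h : i = j
        · subst h; simp
        · simp [h]
      rw [this, Matrix.mulVec_single_one]
      funext i
      simp [dPlusBasis, hj]
    · obtain ⟨w, hw, hw'⟩ := dPlusBasis_col_of_ne_last hj
      obtain ⟨x, hx⟩ := exists_dPlusBasis_mulVec_eq hN (fun i => w (σ i))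
        (by rwa [Equiv.sum_comp σ w])
      exact ⟨x, by rw [hx]; funext i; exact (hw' _).symm⟩
  choose x hx using key
  refine ⟨fun i j => x j i, ?_⟩
  ext i j
  rw [Perm.permMatrix, PEquiv.toMatrix_toPEquiv_mul]
  exact congrFun (hx j) i

/-- The Gram matrix of the basis of `D_n⁺` is integral with even diagonal when `8 ∣ n`. -/
theorem exists_dPlusBasis_gram {N : ℕ} (hN : 8 ∣ N + 2) :
    ∃ G : Matrix (Fin (N + 2)) (Fin (N + 2)) ℤ, (∀ i, 2 ∣ G i i) ∧
      G.map (Int.castRingHom ℚ) = (dPlusBasis N)ᵀ * dPlusBasis N := by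
  obtain ⟨k, hk⟩ := hN
  set z := Fin.last (N + 1) with hz
  have hkQ : ((N : ℚ) + 2) = 8 * k := by exact_mod_cast hk
  have hzz : ∑ i, dPlusBasis N i z * dPlusBasis N i z = ((2 * k : ℤ) : ℚ) := by
    simp [dPlusBasis, hz, hkQ]; ring
  have hlast : ∀ j, j ≠ z → ∃ g : ℤ, ∑ i, dPlusBasis N i z * dPlusBasis N i j = g := by
    intro j hj
    obtain ⟨w, ⟨s, hs⟩, hw'⟩ := dPlusBasis_col_of_ne_last hj
    have hs' : ∑ i, (w i : ℚ) = 2 * s := by exact_mod_cast hs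
    refine ⟨s, ?_⟩
    simp only [hw']
    simp only [dPlusBasis, ← hz, if_true, ← Finset.mul_sum, hs']
    ring
  have hentry : ∀ j l, ∃ g : ℤ, ∑ i, dPlusBasis N i j * dPlusBasis N i l = g := by
    intro j l
    by_cases hj : j = z
    · by_cases hl : l = z
      · rw [hj, hl]; exact ⟨_, hzz⟩
      · rw [hj]; exact hlast l hl
    · by_cases hl : l = z
      · rw [hl]; simp only [mul_comm (dPlusBasis N _ j)]; exact hlast j hj
      · obtain ⟨w, -, hw⟩ := dPlusBasis_col_of_ne_last hj
        obtain ⟨v, -, hv⟩ := dPlusBasis_col_of_ne_last hl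
        exact ⟨∑ i, w i * v i, by simp [hw, hv]⟩
  choose g hg using hentry
  refine ⟨g, fun j => ?_, ?_⟩
  · by_cases hj : j = z
    · subst hj
      have h := (hg z z).symm.trans hzz
      exact ⟨k, by exact_mod_cast h⟩
    · obtain ⟨w, hw, hw'⟩ := dPlusBasis_col_of_ne_last hj
      have h : g j j = ∑ i, w i * w i := by
        have := (hg j j).symm
        simp only [hw'] at this
        exact_mod_cast this
      have h2 : (2 : ℤ) ∣ ∑ i, (w i * w i - w i) := Finset.dvd_sum fun i _ => by
        have := (Int.even_mul_pred_self (w i)).two_dvd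
        rwa [mul_sub, mul_one] at this
      rw [Finset.sum_sub_distrib] at h2
      rw [h]
      exact (dvd_sub_left hw).1 h2
  · ext j l
    exact (hg j l).symm

/-- All eigenvalues of a positive definite real matrix are positive roots of its characteristic
polynomial. -/
theorem card_roots_charpoly_of_posDef {ι : Type*} [Fintype ι] [DecidableEq ι]
    {A : Matrix ι ι ℝ} (hA : A.PosDef) :
    Multiset.card (A.charpoly.roots.filter fun x => 0 < x) = Fintype.card ι ∧
    Multiset.card (A.charpoly.roots.filter fun x => x < 0) = 0 := by
  have hroots := hA.isHermitian.roots_charpoly_eq_eigenvalues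
  have hpos : ∀ x ∈ A.charpoly.roots, 0 < x := by
    intro x hx
    rw [hroots, Multiset.mem_map] at hx
    obtain ⟨i, -, rfl⟩ := hx
    exact hA.eigenvalues_pos i
  constructor
  · rw [Multiset.filter_eq_self.2 hpos, hroots]
    simp
  · rw [Multiset.filter_eq_nil.2 fun x hx => (hpos x hx).not_gt]
    simp

theorem permMatrix_pow {ι R : Type*} [Fintype ι] [DecidableEq ι] [Semiring R] (σ : Perm ι)
    (k : ℕ) : (σ ^ k).permMatrix R = σ.permMatrix R ^ k := by
  induction k with
  | zero => simp
  | succ k ih => rw [pow_succ', Matrix.permMatrix_mul, ih, pow_succ]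

/-- Every coordinate permutation of an even unimodular lattice `D_n⁺` is a semisimple isometry. -/
theorem hasSemisimpleIsometry_charpoly_permMatrix {n : ℕ} (hn : 2 ≤ n) (h8 : 8 ∣ n)
    (σ : Perm (Fin n)) :
    HasSemisimpleIsometryEvenUnimodularZLattice n 0 (σ.permMatrix ℤ).charpoly := by
  obtain ⟨N, rfl⟩ := Nat.exists_eq_add_of_le' hn
  obtain ⟨T, hT⟩ := exists_dPlusBasis_mul_eq_permMatrix_mul (by omega) σ
  obtain ⟨G, hGeven, hG⟩ := exists_dPlusBasis_gram h8
  set B := dPlusBasis N with hB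
  have hinj : Function.Injective fun M : Matrix (Fin (N + 2)) (Fin (N + 2)) ℤ =>
      M.map (Int.castRingHom ℚ) := Matrix.map_injective Int.cast_injective
  have hBdet : IsUnit B.det := by rw [hB, det_dPlusBasis]; exact isUnit_one
  have hdet : G.det = 1 := by
    have h : ((G.det : ℤ) : ℚ) = 1 := by
      rw [← eq_intCast (Int.castRingHom ℚ), RingHom.map_det, RingHom.mapMatrix_apply, hG, Matrix.det_mul,
        Matrix.det_transpose, hB, det_dPlusBasis, one_mul]
    exact_mod_cast h
  have hTG : Tᵀ * G * T = G := by
    apply hinj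
    simp only [Matrix.map_mul, Matrix.transpose_map]
    rw [hG, mul_assoc, mul_assoc, hT, ← mul_assoc, ← Matrix.transpose_mul, hT,
      Matrix.transpose_mul, mul_assoc, ← mul_assoc _ _ B, Matrix.transpose_permMatrix,
      ← Matrix.permMatrix_mul, mul_inv_cancel, Matrix.permMatrix_one, one_mul]
  have hTconj : T.map (Int.castRingHom ℚ) = B⁻¹ * σ.permMatrix ℚ * B := by
    rw [mul_assoc, ← hT, ← mul_assoc, Matrix.nonsing_inv_mul _ hBdet, one_mul]
  have hTpow : ∀ k, T.map (Int.castRingHom ℚ) ^ k = B⁻¹ * (σ ^ k).permMatrix ℚ * B := by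
    intro k
    induction k with
    | zero => simp [Matrix.nonsing_inv_mul _ hBdet]
    | succ k ih =>
      rw [pow_succ, ih, mul_assoc, hT, ← mul_assoc, mul_assoc B⁻¹, permMatrix_pow, permMatrix_pow,
        pow_succ]
  have hposdef : (G.map (Int.castRingHom ℝ)).PosDef := by
    have h : G.map (Int.castRingHom ℝ) =
        (B.map (Rat.castHom ℝ))ᴴ * B.map (Rat.castHom ℝ) := by
      rw [Matrix.conjTranspose_eq_transpose_of_trivial, ← Matrix.transpose_map, ← Matrix.map_mul,
        ← hG, Matrix.map_map]
      congr 1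
    rw [h]
    apply Matrix.PosDef.conjTranspose_mul_self
    apply Matrix.mulVec_injective_of_isUnit
    rw [Matrix.isUnit_iff_isUnit_det, ← RingHom.mapMatrix_apply, ← RingHom.map_det]
    exact hBdet.map _
  have hcard := card_roots_charpoly_of_posDef hposdef
  rw [Fintype.card_fin] at hcard
  change ∃ G T : Matrix (Fin (N + 2)) (Fin (N + 2)) ℤ, _
  refine ⟨G, T, ?_, hGeven, Or.inl hdet, hcard.1, hcard.2, ?_, hTG, ?_, ?_⟩
  · apply hinj
    change Gᵀ.map _ = G.map _
    rw [Matrix.transpose_map, hG, Matrix.transpose_mul, Matrix.transpose_transpose]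
  · have h := congrArg Matrix.det hTG
    rw [Matrix.det_mul, Matrix.det_mul, Matrix.det_transpose, hdet, mul_one] at h
    exact IsUnit.of_mul_eq_one _ h
  · have hord : (orderOf σ : ℚ) ≠ 0 := by exact_mod_cast (orderOf_pos σ).ne'
    refine Module.End.isSemisimple_of_squarefree_aeval_eq_zero
      (p := X ^ orderOf σ - C 1)
      (Polynomial.separable_X_pow_sub_C 1 hord one_ne_zero).squarefree ?_
    simp only [map_sub, map_pow, aeval_X, map_one]
    rw [← Matrix.toLin'_pow, hTpow, pow_orderOf_eq_one, Matrix.permMatrix_one, mul_one,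
      Matrix.nonsing_inv_mul _ hBdet, Matrix.toLin'_one]
    exact sub_self _
  · have h : (σ.permMatrix ℤ).map (Int.castRingHom ℚ) = σ.permMatrix ℚ := by
      ext i j
      simp [Perm.permMatrix, PEquiv.toMatrix_apply, apply_ite]
    rw [hTconj, ← Matrix.charpoly_map, h, mul_assoc, Matrix.charpoly_mul_comm, mul_assoc,
      Matrix.mul_nonsing_inv _ hBdet, mul_one]

/-- The characteristic polynomial of the translation by `1` on `ZMod p` is `X ^ p - 1`. -/
theorem charpoly_permMatrix_addRight_one (p : ℕ) [NeZero p] (R : Type*) [CommRing R] :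
    ((Equiv.addRight (1 : ZMod p)).permMatrix R).charpoly = X ^ p - 1 := by
  nontriviality R
  set P := (Equiv.addRight (1 : ZMod p)).permMatrix R with hP
  have hp : 0 < p := Nat.pos_of_ne_zero (NeZero.ne p)
  have hpow : ∀ k : ℕ, P ^ k = (Equiv.addRight (k : ZMod p)).permMatrix R := by
    intro k
    rw [hP, ← permMatrix_pow]
    congr 1
    ext x
    simp
  have hzero : aeval P (P.charpoly - (X ^ p - 1)) = 0 := by
    simp [Matrix.aeval_self_charpoly, hpow]
  have hdeg : (P.charpoly - (X ^ p - 1)).degree < (p : WithBot ℕ) := by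
    have h1 : P.charpoly.degree = (p : WithBot ℕ) := by
      rw [Matrix.charpoly_degree_eq_dim, ZMod.card]
    rw [← h1]
    have h2 : (X ^ p - 1 : R[X]).degree = (p : WithBot ℕ) := degree_X_pow_sub_C hp 1
    refine degree_sub_lt_left (h1.trans h2.symm) P.charpoly_monic.ne_zero ?_
    exact P.charpoly_monic.leadingCoeff.trans (monic_X_pow_sub_C (1 : R) hp.ne').leadingCoeff.symm
  rw [← sub_eq_zero]
  set r := P.charpoly - (X ^ p - 1)
  by_contra hr
  have hnat : r.natDegree < p := (natDegree_lt_iff_degree_lt hr).2 hdeg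
  refine hr ?_
  ext l
  rw [coeff_zero]
  by_cases hl : l < p
  · have h := congrFun (congrFun hzero 0) (l : ZMod p)
    rw [aeval_eq_sum_range' hnat, Matrix.sum_apply] at h
    rw [Finset.sum_eq_single l] at h
    · simpa [hpow, Perm.permMatrix, PEquiv.toMatrix_apply] using h
    · intro k hk hkl
      have : ((k : ℕ) : ZMod p) ≠ (l : ZMod p) := by
        rw [Ne, ZMod.natCast_eq_natCast_iff', Nat.mod_eq_of_lt (Finset.mem_range.1 hk),
          Nat.mod_eq_of_lt hl]
        exact hkl
      simp [hpow, Perm.permMatrix, PEquiv.toMatrix_apply, this]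
    · simp [hl]
  · exact coeff_eq_zero_of_degree_lt (hdeg.trans_le (by exact_mod_cast not_lt.1 hl))

theorem charpoly_permMatrix_sumCongr {ι κ R : Type*} [Fintype ι] [DecidableEq ι] [Fintype κ]
    [DecidableEq κ] [CommRing R] (σ : Perm ι) (τ : Perm κ) :
    ((Perm.sumCongr σ τ).permMatrix R).charpoly =
      (σ.permMatrix R).charpoly * (τ.permMatrix R).charpoly := by
  have h : (Perm.sumCongr σ τ).permMatrix R =
      Matrix.fromBlocks (σ.permMatrix R) 0 0 (τ.permMatrix R) := by
    ext (i | i) (j | j) <;> simp [Perm.permMatrix, PEquiv.toMatrix_apply]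
  rw [h, Matrix.charpoly_fromBlocks_zero₁₂]

theorem charpoly_permMatrix_permCongr {ι κ R : Type*} [Fintype ι] [DecidableEq ι] [Fintype κ]
    [DecidableEq κ] [CommRing R] (e : ι ≃ κ) (σ : Perm ι) :
    ((e.permCongr σ).permMatrix R).charpoly = (σ.permMatrix R).charpoly := by
  rw [← Matrix.charpoly_reindex e (σ.permMatrix R)]
  congr 1
  ext i j
  simp [Perm.permMatrix, PEquiv.toMatrix_apply, Equiv.eq_symm_apply]

theorem cyclotomic_mul_pow_definite_lattice (p : ℕ) (hp : p.Prime) (hodd : p ≠ 2)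
    (m : ℕ) (hm : 2 ≤ m) (h8 : (p - 1 + m) % 8 = 0) :
    HasSemisimpleIsometryEvenUnimodularZLattice (p - 1 + m) 0
      (Polynomial.cyclotomic p ℤ * (X - 1) ^ m) := by
  have : Fact p.Prime := ⟨hp⟩
  obtain ⟨k, rfl⟩ := Nat.exists_eq_add_of_le' (one_le_two.trans hm)
  have hcard : Fintype.card (ZMod p ⊕ Fin k) = Fintype.card (Fin (p - 1 + (k + 1))) := by
    have := hp.pos
    simp only [Fintype.card_sum, ZMod.card, Fintype.card_fin]
    omega
  have h := hasSemisimpleIsometry_charpoly_permMatrix (by omega) (Nat.dvd_of_mod_eq_zero h8)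
    ((Fintype.equivOfCardEq hcard).permCongr
      (Perm.sumCongr (Equiv.addRight (1 : ZMod p)) (1 : Perm (Fin k))))
  rw [charpoly_permMatrix_permCongr, charpoly_permMatrix_sumCongr,
    charpoly_permMatrix_addRight_one, Matrix.permMatrix_one, Matrix.charpoly_one,
    Fintype.card_fin, ← Polynomial.cyclotomic_prime_mul_X_sub_one] at h
  rwa [pow_succ', ← mul_assoc]
end

section
/- Let F(X) = (X⁴ − X² + 1)·(X − 1)⁴ ∈ ℤ[X]. Then: (a) no positive definite even unimodular ℤ-lattice of rank 8 has a semisimple isometry with characteristic polynomial F; and (b) there exists an even unimodular ℤ-lattice of signature (4,4) having a semisimple isometry with characteristic polynomial F. -/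
open Polynomial Matrix

open MeasureTheory in
lemma volume_sum_sq_lt_two :
    (2 : ENNReal) ^ 4 < volume {x : Fin 4 → ℝ | ∑ i, x i ^ 2 < 2} := by
  have h := MeasureTheory.volume_sum_rpow_lt (ι := Fin 4) (p := 2) (by norm_num) (Real.sqrt 2)
  have hset : {x : Fin 4 → ℝ | (∑ i, |x i| ^ (2 : ℝ)) ^ (1 / (2 : ℝ)) < Real.sqrt 2}
      = {x : Fin 4 → ℝ | ∑ i, x i ^ 2 < 2} := by
    ext x
    simp only [Set.mem_ofPred_eq, Real.rpow_ofNat, sq_abs, ← Real.sqrt_eq_rpow]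
    exact Real.sqrt_lt_sqrt_iff (Finset.sum_nonneg fun i _ => sq_nonneg _)
  have hG : Real.Gamma (1 / 2 + 1) = Real.sqrt Real.pi / 2 := by
    rw [Real.Gamma_add_one (by norm_num), Real.Gamma_one_half_eq]; ring
  have hG3 : Real.Gamma (((4 : ℕ) : ℝ) / 2 + 1) = 2 := by
    rw [show (((4 : ℕ) : ℝ) / 2 + 1) = ((2 : ℕ) : ℝ) + 1 by norm_num, Real.Gamma_nat_eq_factorial]
    norm_num
  rw [hset, Fintype.card_fin, hG, hG3, ← ENNReal.ofReal_pow (by positivity),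
    ← ENNReal.ofReal_mul (by positivity)] at h
  rw [h, show (2 : ENNReal) ^ 4 = ENNReal.ofReal (2 ^ 4) by simp [ENNReal.ofReal_pow]]
  refine (ENNReal.ofReal_lt_ofReal_iff (by positivity)).2 ?_
  have h2 : Real.sqrt 2 ^ 4 = 4 := by
    rw [show 4 = 2 * 2 by rfl, pow_mul, Real.sq_sqrt (by norm_num)]; norm_num
  have h3 : (2 * (Real.sqrt Real.pi / 2)) ^ 4 = Real.pi ^ 2 := by
    rw [show 2 * (Real.sqrt Real.pi / 2) = Real.sqrt Real.pi by ring,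
      show 4 = 2 * 2 by rfl, pow_mul, Real.sq_sqrt Real.pi_pos.le]
  rw [h2, h3]
  nlinarith [Real.pi_gt_three]

open MeasureTheory in
/-- A positive semidefinite quadratic form in four variables of determinant one takes a value
less than two at some nonzero integer vector. -/
lemma exists_int_vec_quadForm_lt_two (Q : Matrix (Fin 4) (Fin 4) ℝ) (hQ : Q.PosSemidef)
    (hdet : |Q.det| = 1) :
    ∃ y : Fin 4 → ℤ, y ≠ 0 ∧ (fun i => (y i : ℝ)) ⬝ᵥ Q *ᵥ (fun i => (y i : ℝ)) < 2 := by
  obtain ⟨M, rfl⟩ : ∃ M : Matrix (Fin 4) (Fin 4) ℝ, Q = Mᵀ * M := by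
    open scoped MatrixOrder in
    obtain ⟨M, hM⟩ := CStarAlgebra.nonneg_iff_eq_star_mul_self.mp hQ.nonneg
    exact ⟨M, by simpa [Matrix.star_eq_conjTranspose] using hM⟩
  have hM : |M.det| = 1 := by
    rw [det_mul, det_transpose, abs_mul] at hdet
    nlinarith [abs_nonneg M.det]
  have hM0 : M.det ≠ 0 := by
    intro h; simp [h] at hM
  have hval (x : Fin 4 → ℝ) : x ⬝ᵥ (Mᵀ * M) *ᵥ x = ∑ i, (M *ᵥ x) i ^ 2 := by
    rw [← mulVec_mulVec, dotProduct_mulVec, vecMul_transpose, dotProduct]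
    exact Finset.sum_congr rfl fun i _ => (sq _).symm
  have hball : Convex ℝ {x : Fin 4 → ℝ | ∑ i, x i ^ 2 < 2} := by
    have : ConvexOn ℝ Set.univ (fun x : Fin 4 → ℝ => ∑ i, x i ^ 2) := by
      refine ⟨convex_univ, fun x _ y _ a b ha hb hab => ?_⟩
      simp only [smul_eq_mul, Finset.mul_sum, ← Finset.sum_add_distrib]
      refine Finset.sum_le_sum fun i _ => ?_
      obtain rfl : b = 1 - a := by linarith
      simp only [Pi.add_apply, Pi.smul_apply, smul_eq_mul]
      nlinarith [mul_nonneg (mul_nonneg ha hb) (sq_nonneg (x i - y i))]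
    simpa using this.convex_lt 2
  have hvol : volume (Matrix.toLin' M ⁻¹' {x : Fin 4 → ℝ | ∑ i, x i ^ 2 < 2})
      = volume {x : Fin 4 → ℝ | ∑ i, x i ^ 2 < 2} := by
    rw [Measure.addHaar_preimage_linearMap _ (by simpa using hM0)]
    simp [abs_inv, hM]
  have hfund := ZSpan.isAddFundamentalDomain' (Pi.basisFun ℝ (Fin 4)) volume
  have : Countable (Submodule.span ℤ (Set.range (Pi.basisFun ℝ (Fin 4)))).toAddSubgroup :=
    inferInstanceAs (Countable (Submodule.span ℤ (Set.range (Pi.basisFun ℝ (Fin 4)))))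
  obtain ⟨⟨x, hx⟩, hx0, hxs⟩ :=
    exists_ne_zero_mem_lattice_of_measure_mul_two_pow_lt_measure hfund
      (s := Matrix.toLin' M ⁻¹' {x : Fin 4 → ℝ | ∑ i, x i ^ 2 < 2})
      (fun x hx => by simpa [mulVec_neg] using hx)
      (hball.linear_preimage _) (by
        rw [hvol, ZSpan.volume_fundamentalDomain]
        have : (Matrix.of (Pi.basisFun ℝ (Fin 4))).det = 1 := by
          rw [← det_one (n := Fin 4) (R := ℝ)]
          congr 1
          ext i j
          simp [Matrix.one_apply, Pi.single_apply, eq_comm]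
        simpa [this] using volume_sum_sq_lt_two)
  rw [Submodule.mem_toAddSubgroup, Module.Basis.mem_span_iff_repr_mem] at hx
  choose y hy using hx
  obtain rfl : (fun i => (y i : ℝ)) = x := by
    ext i; simpa using hy i
  refine ⟨y, ?_, ?_⟩
  · rintro rfl
    apply hx0
    ext i; simp
  · rw [hval]
    simpa using hxs

/-- A symmetric integer matrix with even diagonal has even quadratic form. -/
lemma even_dotProduct_mulVec_self {ι : Type*} [Fintype ι] [DecidableEq ι]
    (G : Matrix ι ι ℤ) (hG : G.IsSymm) (hd : ∀ i, 2 ∣ G i i) (x : ι → ℤ) :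
    2 ∣ x ⬝ᵥ G *ᵥ x := by
  have key : ∑ p : ι × ι, ((x p.1 * (G p.1 p.2 * x p.2) : ℤ) : ZMod 2) = 0 := by
    refine Finset.sum_involution (fun p _ => p.swap) ?_ ?_ (fun _ _ => Finset.mem_univ _)
      (fun p _ => p.swap_swap)
    · rintro ⟨i, j⟩ -
      rw [← Int.cast_add]
      refine (ZMod.intCast_zmod_eq_zero_iff_dvd _ 2).2 ⟨x i * (G i j * x j), ?_⟩
      simp only [Prod.swap, hG.apply i j]
      push_cast
      ring
    · rintro ⟨i, j⟩ - h heq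
      apply h
      obtain rfl : j = i := congrArg Prod.fst heq
      refine (ZMod.intCast_zmod_eq_zero_iff_dvd _ 2).2 ?_
      exact Dvd.dvd.mul_left (Dvd.dvd.mul_right (hd _) _) _
  have h2 : ((x ⬝ᵥ G *ᵥ x : ℤ) : ZMod 2) = 0 := by
    rw [← key, Fintype.sum_prod_type]
    simp only [dotProduct, mulVec, Finset.mul_sum, Int.cast_sum]
  exact_mod_cast (ZMod.intCast_zmod_eq_zero_iff_dvd _ 2).1 h2

/-- An idempotent integer matrix factors through a free module, with rank given by the trace. -/
lemma exists_factor_of_isIdempotentElem {ι : Type*} [Fintype ι] [DecidableEq ι]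
    (P : Matrix ι ι ℤ) (hP : P * P = P) {n : ℕ} (hn : P.trace = n) :
    ∃ (A : Matrix ι (Fin n) ℤ) (B : Matrix (Fin n) ι ℤ), A * B = P ∧ B * A = 1 := by
  let f := Matrix.toLin' P
  let b := Module.finBasis ℤ (LinearMap.range f)
  let e := Pi.basisFun ℤ ι
  let A := LinearMap.toMatrix b e (LinearMap.range f).subtype
  let B := LinearMap.toMatrix e b f.rangeRestrict
  have hf : f ∘ₗ f = f := by
    rw [← Matrix.toLin'_mul, hP]
  have hAB : A * B = P := by
    rw [← LinearMap.toMatrix_comp]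
    exact LinearMap.toMatrix'_toLin' P
  have hBA : B * A = 1 := by
    rw [← LinearMap.toMatrix_comp, ← LinearMap.toMatrix_id b]
    congr 1
    ext ⟨x, y, rfl⟩ : 2
    exact LinearMap.congr_fun hf y
  obtain rfl : Module.finrank ℤ (LinearMap.range f) = n := by
    have : (A * B).trace = (B * A).trace := Matrix.trace_mul_comm A B
    rw [hAB, hBA, hn, Matrix.trace_one, Fintype.card_fin] at this
    exact_mod_cast this.symm
  exact ⟨A, B, hAB, hBA⟩

lemma dotProduct_map_mulVec_intCast {ι : Type*} [Fintype ι] (H : Matrix ι ι ℤ) (z : ι → ℤ) :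
    (fun i => (z i : ℝ)) ⬝ᵥ (H.map (Int.castRingHom ℝ)) *ᵥ (fun i => (z i : ℝ)) =
      ((z ⬝ᵥ H *ᵥ z : ℤ) : ℝ) := by
  simp [dotProduct, mulVec]

/-- A positive definite even unimodular lattice has no orthogonal direct summand of rank four. -/
lemma trace_ne_four_of_posDef_even_unimodular {ι : Type*} [Fintype ι] [DecidableEq ι]
    (G P : Matrix ι ι ℤ) (hG : G.IsSymm) (hd : ∀ i, 2 ∣ G i i) (hdet : IsUnit G.det)
    (hpos : (G.map (Int.castRingHom ℝ)).PosDef) (hP : P * P = P) (hPG : G * P = Pᵀ * G) :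
    P.trace ≠ 4 := by
  intro htr
  obtain ⟨A, B, rfl, hBA⟩ := exists_factor_of_isIdempotentElem P hP (n := 4) htr
  have hunit : (Aᵀ * G * A) * (B * G⁻¹ * Bᵀ) = 1 := by
    calc (Aᵀ * G * A) * (B * G⁻¹ * Bᵀ) = Aᵀ * (G * (A * B)) * G⁻¹ * Bᵀ := by
          simp only [Matrix.mul_assoc]
      _ = (Aᵀ * Bᵀ) * Aᵀ * (G * G⁻¹) * Bᵀ := by
          rw [hPG, transpose_mul]; simp only [Matrix.mul_assoc]
      _ = 1 := by
          rw [Matrix.mul_nonsing_inv _ hdet, Matrix.mul_one, ← transpose_mul, hBA,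
            transpose_one, Matrix.one_mul, ← transpose_mul, hBA, transpose_one]
  have hdet1 : |(Aᵀ * G * A).det| = 1 :=
    Int.isUnit_iff_abs_eq.1 (IsUnit.of_mul_eq_one _ (by rw [← det_mul, hunit, det_one]))
  let c := Int.castRingHom ℝ
  have hmap : (Aᵀ * G * A).map c = (A.map c)ᴴ * G.map c * A.map c := by
    simp only [Matrix.map_mul, conjTranspose_eq_transpose_of_trivial, transpose_map]
  obtain ⟨y, hy0, hy⟩ := exists_int_vec_quadForm_lt_two ((Aᵀ * G * A).map c)
    (by rw [hmap]; exact hpos.posSemidef.conjTranspose_mul_mul_same _) (by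
      have : ((Aᵀ * G * A).map c).det = ((Aᵀ * G * A).det : ℝ) :=
        (RingHom.map_det c (Aᵀ * G * A)).symm
      rw [this]; exact_mod_cast hdet1)
  have hx0 : A *ᵥ y ≠ 0 := by
    intro h
    apply hy0
    rw [← one_mulVec y, ← hBA, ← mulVec_mulVec, h, mulVec_zero]
  have hval : A *ᵥ y ⬝ᵥ G *ᵥ (A *ᵥ y) = y ⬝ᵥ (Aᵀ * G * A) *ᵥ y := by
    rw [← mulVec_mulVec, ← mulVec_mulVec, dotProduct_mulVec y, vecMul_transpose]
  have hlt : A *ᵥ y ⬝ᵥ G *ᵥ (A *ᵥ y) < 2 := by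
    rw [dotProduct_map_mulVec_intCast, ← hval] at hy
    exact_mod_cast hy
  have hgt : 0 < A *ᵥ y ⬝ᵥ G *ᵥ (A *ᵥ y) := by
    have := hpos.dotProduct_mulVec_pos (x := fun i => ((A *ᵥ y) i : ℝ)) (by
      intro h
      apply hx0
      ext i
      simpa using congrFun h i)
    rw [star_trivial, dotProduct_map_mulVec_intCast] at this
    exact_mod_cast this
  have := even_dotProduct_mulVec_self G hG hd (A *ᵥ y)
  omega

lemma posDef_of_card_pos_roots {n : ℕ} (A : Matrix (Fin n) (Fin n) ℝ) (hA : A.IsHermitian)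
    (h : Multiset.card (A.charpoly.roots.filter fun x => 0 < x) = n) : A.PosDef := by
  rw [hA.posDef_iff_eigenvalues_pos]
  rw [hA.roots_charpoly_eq_eigenvalues] at h
  have := (Multiset.filter_eq_self (p := fun x : ℝ => 0 < x)
    (s := Multiset.map (RCLike.ofReal ∘ hA.eigenvalues) Finset.univ.val)).1
    (Multiset.eq_of_le_of_card_le (Multiset.filter_le _ _) (by rw [h]; simp))
  intro i
  exact this _ (Multiset.mem_map_of_mem _ (Finset.mem_univ i))

/-- The polynomial relation satisfied by a semisimple matrix with the given characteristic
polynomial. -/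
lemma relation_of_isSemisimple {ι : Type*} [Fintype ι] [DecidableEq ι] (T : Matrix ι ι ℤ)
    (hss : Module.End.IsSemisimple (Matrix.toLin' (T.map (Int.castRingHom ℚ))))
    (hT : (T.map (Int.castRingHom ℚ)).charpoly =
      ((X ^ 4 - X ^ 2 + 1) * (X - 1) ^ 4 : ℚ[X])) :
    (T ^ 4 - T ^ 2 + 1) * (T - 1) = 0 := by
  have hdvd : minpoly ℚ (Matrix.toLin' (T.map (Int.castRingHom ℚ))) ∣
      ((X ^ 4 - X ^ 2 + 1) * (X - 1) : ℚ[X]) := by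
    refine hss.minpoly_squarefree.isRadical 4 _ ?_
    have h1 := LinearMap.minpoly_dvd_charpoly (Matrix.toLin' (T.map (Int.castRingHom ℚ)))
    rw [Matrix.charpoly_toLin', hT] at h1
    refine h1.trans ⟨(X ^ 4 - X ^ 2 + 1) ^ 3, by ring⟩
  rw [Matrix.minpoly_toLin'] at hdvd
  have h0 := (minpoly.dvd_iff).1 hdvd
  apply Matrix.map_injective (f := Int.castRingHom ℚ) Int.cast_injective
  have h1 : (Int.castRingHom ℚ).mapMatrix ((T ^ 4 - T ^ 2 + 1) * (T - 1)) =
      (Int.castRingHom ℚ).mapMatrix 0 := by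
    simpa only [map_mul, map_add, map_sub, map_pow, map_one, map_zero, aeval_X,
      RingHom.mapMatrix_apply] using h0
  exact h1

/-- The rational endomorphism attached to an integer matrix, as a ring homomorphism. -/
def matrixIntToEnd {ι : Type*} [Fintype ι] [DecidableEq ι] :
    Matrix ι ι ℤ →+* Module.End ℚ (ι → ℚ) :=
  (Matrix.toLinAlgEquiv' (R := ℚ) (n := ι) : _ →+* _).comp (Int.castRingHom ℚ).mapMatrix

lemma matrixIntToEnd_apply {ι : Type*} [Fintype ι] [DecidableEq ι] (M : Matrix ι ι ℤ) :
    matrixIntToEnd M = Matrix.toLin' (M.map (Int.castRingHom ℚ)) := rfl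

/-- The trace of the projection onto the fixed space. -/
lemma trace_eq_four_of_isSemisimple {ι : Type*} [Fintype ι] [DecidableEq ι] (T : Matrix ι ι ℤ)
    (hss : Module.End.IsSemisimple (Matrix.toLin' (T.map (Int.castRingHom ℚ))))
    (hT : (T.map (Int.castRingHom ℚ)).charpoly =
      ((X ^ 4 - X ^ 2 + 1) * (X - 1) ^ 4 : ℚ[X])) :
    (T ^ 4 - T ^ 2 + 1).trace = 4 := by
  have hrel := relation_of_isSemisimple T hss hT
  set ψ := matrixIntToEnd (ι := ι)
  set f : Module.End ℚ (ι → ℚ) := Matrix.toLin' (T.map (Int.castRingHom ℚ)) with hf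
  have hψ : ψ T = f := matrixIntToEnd_apply T
  have hpf : ψ (T ^ 4 - T ^ 2 + 1) = f ^ 4 - f ^ 2 + 1 := by
    rw [map_add, map_sub, map_pow, map_pow, map_one, hψ]
  have hfp : (f - 1) * (f ^ 4 - f ^ 2 + 1) = 0 := by
    rw [← hpf, ← hψ, ← map_one ψ, ← map_sub, ← map_mul, ← map_zero ψ, ← hrel]
    congr 1
    noncomm_ring
  have hE : f.maxGenEigenspace 1 = f.eigenspace 1 :=
    hss.isFinitelySemisimple.maxGenEigenspace_eq_eigenspace 1
  have hproj : LinearMap.IsProj (f.eigenspace 1) (f ^ 4 - f ^ 2 + 1) := by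
    refine ⟨fun x => ?_, fun x hx => ?_⟩
    · rw [Module.End.mem_eigenspace_iff, one_smul]
      have := LinearMap.congr_fun hfp x
      simpa [sub_eq_zero] using this
    · rw [Module.End.mem_eigenspace_iff, one_smul] at hx
      simp [pow_succ, hx]
  have hrank : Module.finrank ℚ (f.eigenspace 1) = 4 := by
    rw [← hE, LinearMap.finrank_maxGenEigenspace_eq, Matrix.charpoly_toLin', hT]
    have h1 : ((X ^ 4 - X ^ 2 + 1) : ℚ[X]).rootMultiplicity 1 = 0 :=
      Polynomial.rootMultiplicity_eq_zero (by simp)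
    have h2 : ((X ^ 4 - X ^ 2 + 1) : ℚ[X]) ≠ 0 := fun h => by
      simpa using congrArg (Polynomial.eval 1) h
    have h3 : (X - 1 : ℚ[X]) = X - C 1 := by simp
    rw [h3, Polynomial.rootMultiplicity_mul
      (mul_ne_zero h2 (pow_ne_zero _ (Polynomial.X_sub_C_ne_zero 1))), h1,
      Polynomial.rootMultiplicity_X_sub_C_pow]
  have htr := hproj.trace
  rw [← hpf, hrank] at htr
  have h : LinearMap.trace ℚ _ (ψ (T ^ 4 - T ^ 2 + 1)) = ((T ^ 4 - T ^ 2 + 1).trace : ℚ) := by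
    refine (Matrix.trace_toLin'_eq _).trans ?_
    exact (AddMonoidHom.map_trace (Int.castRingHom ℚ) (T ^ 4 - T ^ 2 + 1)).symm
  rw [h] at htr
  exact_mod_cast htr

lemma not_posDef_of_isSemisimple {ι : Type*} [Fintype ι] [DecidableEq ι]
    (G T : Matrix ι ι ℤ) (hG : G.IsSymm) (hd : ∀ i, 2 ∣ G i i) (hdet : IsUnit G.det)
    (hTG : Tᵀ * G * T = G)
    (hss : Module.End.IsSemisimple (Matrix.toLin' (T.map (Int.castRingHom ℚ))))
    (hT : (T.map (Int.castRingHom ℚ)).charpoly =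
      ((X ^ 4 - X ^ 2 + 1) * (X - 1) ^ 4 : ℚ[X])) :
    ¬ (G.map (Int.castRingHom ℝ)).PosDef := by
  intro hpos
  have hrel := relation_of_isSemisimple T hss hT
  have htr := trace_eq_four_of_isSemisimple T hss hT
  set P := T ^ 4 - T ^ 2 + 1 with hPdef
  have hTP : T * P = P := by
    rw [← sub_eq_zero, ← hrel, hPdef]; noncomm_ring
  have hPP : P * P = P := by
    have h2 : T ^ 2 * P = P := by rw [sq, Matrix.mul_assoc, hTP, hTP]
    have h4 : T ^ 4 * P = P := by
      rw [show 4 = 2 + 2 from rfl, pow_add, Matrix.mul_assoc, h2, h2]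
    nth_rw 1 [hPdef]
    rw [Matrix.add_mul, Matrix.sub_mul, h2, h4, Matrix.one_mul, sub_self, zero_add]
  have hTGP : Tᵀ * (G * P) = G * P := by
    nth_rw 1 [← hTP]
    rw [← Matrix.mul_assoc, ← Matrix.mul_assoc, hTG]
  have hPGP : Pᵀ * (G * P) = G * P := by
    have h2 : Tᵀ ^ 2 * (G * P) = G * P := by rw [sq, Matrix.mul_assoc, hTGP, hTGP]
    have h4 : Tᵀ ^ 4 * (G * P) = G * P := by
      rw [show 4 = 2 + 2 from rfl, pow_add, Matrix.mul_assoc, h2, h2]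
    have hPt : Pᵀ = Tᵀ ^ 4 - Tᵀ ^ 2 + 1 := by
      simp [hPdef, transpose_pow]
    rw [hPt, Matrix.add_mul, Matrix.sub_mul, h2, h4, Matrix.one_mul, sub_self, zero_add]
  refine trace_ne_four_of_posDef_even_unimodular G P hG hd hdet hpos hPP ?_ htr
  have := congrArg Matrix.transpose hPGP
  simp only [transpose_mul, transpose_transpose, hG.eq] at this
  rw [← this, Matrix.mul_assoc, hPGP]

lemma not_hasSemisimpleIsometry_eight_zero :
    ¬ HasSemisimpleIsometryEvenUnimodularZLattice 8 0
        ((X ^ 4 - X ^ 2 + 1) * (X - 1) ^ 4) := by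
  rintro ⟨G, T, hG, hd, hdet, hp, -, -, hTG, hss, hT⟩
  refine not_posDef_of_isSemisimple G T hG hd (Int.isUnit_iff.2 hdet) hTG hss
    (by rw [hT]; simp) (posDef_of_card_pos_roots _ ?_ hp)
  rw [Matrix.IsHermitian, conjTranspose_eq_transpose_of_trivial]
  exact hG.map _

/-- The path-graph form, invariant under the companion matrix of the twelfth cyclotomic
polynomial. -/
def pathGram : Matrix (Fin 4) (Fin 4) ℤ := !![0,1,0,0; 1,0,1,0; 0,1,0,1; 0,0,1,0]

/-- The companion matrix of the twelfth cyclotomic polynomial. -/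
def companionTwelve : Matrix (Fin 4) (Fin 4) ℤ := !![0,0,0,-1; 1,0,0,0; 0,1,0,1; 0,0,1,0]

lemma pathGram_isometry : companionTwelveᵀ * pathGram * companionTwelve = pathGram := by
  decide

lemma pathGram_det : pathGram.det = 1 := by
  simp [pathGram, Matrix.det_succ_row_zero, Fin.sum_univ_succ, Fin.succAbove]

lemma companionTwelve_det : companionTwelve.det = 1 := by
  simp [companionTwelve, Matrix.det_succ_row_zero, Fin.sum_univ_succ, Fin.succAbove]

lemma pathGram_charpoly : pathGram.charpoly = X ^ 4 - 3 * X ^ 2 + 1 := by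
  simp [pathGram, Matrix.charpoly, Matrix.charmatrix, Matrix.det_succ_row_zero,
    Fin.sum_univ_succ, Fin.succAbove]
  ring

lemma companionTwelve_charpoly : companionTwelve.charpoly = X ^ 4 - X ^ 2 + 1 := by
  simp [companionTwelve, Matrix.charpoly, Matrix.charmatrix, Matrix.det_succ_row_zero,
    Fin.sum_univ_succ, Fin.succAbove]
  ring

lemma pathGram_isSymm : pathGram.IsSymm := by decide

lemma squarefree_relation : Squarefree ((X ^ 4 - X ^ 2 + 1) * (X - 1) : ℚ[X]) := by
  have h : (X ^ 12 - 1 : ℚ[X]).Separable :=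
    Polynomial.X_pow_sub_one_separable_iff.2 (by norm_num)
  refine h.squarefree.squarefree_of_dvd
    ⟨X ^ 7 + X ^ 6 + 2 * X ^ 5 + 2 * X ^ 4 + 2 * X ^ 3 + 2 * X ^ 2 + X + 1, by ring⟩

lemma exists_pathGram_roots : ∃ φ ψ : ℝ, 0 < φ ∧ ψ < 0 ∧
    (pathGram.map (Int.castRingHom ℝ)).charpoly.roots = {φ, ψ, -φ, -ψ} := by
  refine ⟨Real.goldenRatio, Real.goldenConj, Real.goldenRatio_pos, Real.goldenConj_neg, ?_⟩
  rw [Matrix.charpoly_map, pathGram_charpoly]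
  have : ((X ^ 4 - 3 * X ^ 2 + 1 : ℤ[X]).map (Int.castRingHom ℝ)) =
      (({Real.goldenRatio, Real.goldenConj, -Real.goldenRatio, -Real.goldenConj} : Multiset ℝ).map
        fun a => X - C a).prod := by
    have h1 : (C Real.goldenRatio + C Real.goldenConj : ℝ[X]) = 1 := by
      rw [← C_add, Real.goldenRatio_add_goldenConj, C_1]
    have h2 : (C Real.goldenRatio * C Real.goldenConj : ℝ[X]) = -1 := by
      rw [← C_mul, Real.goldenRatio_mul_goldenConj, C_neg, C_1]
    simp
    grind
  rw [this, Polynomial.roots_multiset_prod_X_sub_C]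

lemma hasSemisimpleIsometry_four_four :
    HasSemisimpleIsometryEvenUnimodularZLattice 4 4
        ((X ^ 4 - X ^ 2 + 1) * (X - 1) ^ 4) := by
  let e : Fin 4 ⊕ Fin 4 ≃ Fin (4 + 4) := finSumFinEquiv
  let G₀ : Matrix (Fin 4 ⊕ Fin 4) (Fin 4 ⊕ Fin 4) ℤ := fromBlocks pathGram 0 0 pathGram
  let T₀ : Matrix (Fin 4 ⊕ Fin 4) (Fin 4 ⊕ Fin 4) ℤ := fromBlocks companionTwelve 0 0 1
  obtain ⟨φ, ψ, hφ, hψ, hr⟩ := exists_pathGram_roots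
  have hroots : ((Matrix.reindex e e G₀).map (Int.castRingHom ℝ)).charpoly.roots =
      {φ, ψ, -φ, -ψ} +
      {φ, ψ, -φ, -ψ} := by
    rw [Matrix.charpoly_map, Matrix.charpoly_reindex, Matrix.charpoly_fromBlocks_zero₁₂,
      Polynomial.map_mul, ← Matrix.charpoly_map, Polynomial.roots_mul, hr]
    exact mul_ne_zero (Matrix.charpoly_monic _).ne_zero (Matrix.charpoly_monic _).ne_zero
  have hchar : (Matrix.reindex e e T₀).charpoly = (X ^ 4 - X ^ 2 + 1) * (X - 1) ^ 4 := by
    rw [Matrix.charpoly_reindex, Matrix.charpoly_fromBlocks_zero₁₂, companionTwelve_charpoly,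
      Matrix.charpoly_one, Fintype.card_fin]
  have hrel : ((Matrix.reindex e e T₀) ^ 4 - (Matrix.reindex e e T₀) ^ 2 + 1) *
      (Matrix.reindex e e T₀ - 1) = 0 := by
    decide +kernel
  refine ⟨Matrix.reindex e e G₀, Matrix.reindex e e T₀, ?_, ?_, ?_, ?_, ?_, ?_, ?_, ?_, ?_⟩
  · exact (Matrix.IsSymm.fromBlocks pathGram_isSymm (by simp) pathGram_isSymm).submatrix _
  · decide
  · left
    rw [Matrix.det_reindex_self, Matrix.det_fromBlocks_zero₁₂, pathGram_det, one_mul]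
  · rw [hroots]
    simp [Multiset.filter_singleton, hφ, hφ.not_gt, hψ, hψ.not_gt]
  · rw [hroots]
    simp [Multiset.filter_singleton, hφ, hφ.not_gt, hψ, hψ.not_gt]
  · rw [Matrix.det_reindex_self, Matrix.det_fromBlocks_zero₁₂, companionTwelve_det]
    simp
  · decide +kernel
  · refine Module.End.isSemisimple_of_squarefree_aeval_eq_zero squarefree_relation ?_
    have h := congrArg matrixIntToEnd hrel
    simpa only [map_mul, map_add, map_sub, map_pow, map_one, map_zero, aeval_X,
      matrixIntToEnd_apply] using h
  · rw [Matrix.charpoly_map, hchar]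

theorem example_polynomial_E8_and_hyperbolic :
    ¬ HasSemisimpleIsometryEvenUnimodularZLattice 8 0
        ((X ^ 4 - X ^ 2 + 1) * (X - 1) ^ 4) ∧
    HasSemisimpleIsometryEvenUnimodularZLattice 4 4
        ((X ^ 4 - X ^ 2 + 1) * (X - 1) ^ 4) :=
  ⟨not_hasSemisimpleIsometry_eight_zero, hasSemisimpleIsometry_four_four⟩
end
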